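/- arXiv:1501.02177 — 5 statements merged into one kernel-verified Lean document; each statement's English description precedes it below -/
import Mathlib

section
/- Let d ∈ {1,2} and let v be a complex-valued Schwartz function on ℝ^{3-d} × ℝ^d. Let p = 1 if d = 1, and let p be any real number in [1,2) if d = 2. Then there exists a constant C > 0 (depending on v, d and p but not on γ) such that for all γ ∈ (0,1]: ∫_{ℝ^{3-d} × ℝ^d} (γ²|k_x|² / (γ²|k_x|² + |k_z|²)) · |𝓕v(k_x,k_z)| dk_x dk_z ≤ C γ^p. -/
open MeasureTheory Set
open scoped RealInnerProductSpace ENNReal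

noncomputable section

/-- The confined directions `ℝ^{3-d}`. -/
abbrev SpX (d : ℕ) : Type := EuclideanSpace ℝ (Fin (3 - d))

/-- The transversal directions `ℝ^d`. -/
abbrev SpZ (d : ℕ) : Type := EuclideanSpace ℝ (Fin d)

/-- The Fourier transform `𝓕u(k) = ∫ u(x) e^{-i k·x} dx` on `ℝ^{3-d} × ℝ^d`. -/
def FT (d : ℕ) (u : SpX d × SpZ d → ℂ) (k : SpX d × SpZ d) : ℂ :=
  ∫ x : SpX d × SpZ d,
    Complex.exp (-Complex.I * ((⟪k.1, x.1⟫ + ⟪k.2, x.2⟫ : ℝ) : ℂ)) * u x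

/-- The Fourier integral of `FT`, expressed through Mathlib's Fourier transform on the `L²` product
of the two factors. -/
theorem FT_eq_fourier (d : ℕ) (u : SpX d × SpZ d → ℂ) (k : SpX d × SpZ d) :
    FT d u k = FourierTransform.fourier (fun y : WithLp 2 (SpX d × SpZ d) => u (WithLp.ofLp y))
      ((2 * Real.pi)⁻¹ • WithLp.toLp 2 k) := by
  rw [Real.fourier_eq']
  rw [← (WithLp.volume_preserving_toLp (SpX d) (SpZ d)).integral_comp
    (MeasurableEquiv.toLp 2 (SpX d × SpZ d)).measurableEmbedding, FT]
  congr 1 with x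
  rw [inner_smul_right, WithLp.prod_inner_apply, smul_eq_mul]
  congr 2
  have : (Real.pi : ℂ) ≠ 0 := by exact_mod_cast Real.pi_ne_zero
  simp only [real_inner_comm]
  push_cast
  field_simp

/-- The Fourier transform of a Schwartz function decays polynomially in both variables. -/
theorem exists_norm_FT_le (d n : ℕ) (v : SchwartzMap (SpX d × SpZ d) ℂ) :
    ∃ C : ℝ, 0 ≤ C ∧ ∀ k : SpX d × SpZ d,
      ‖FT d v k‖ ≤ C * (((1 + ‖k.1‖) ^ n)⁻¹ * ((1 + ‖k.2‖) ^ n)⁻¹) := by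
  let w : SchwartzMap (WithLp 2 (SpX d × SpZ d)) ℂ :=
    SchwartzMap.compCLMOfContinuousLinearEquiv ℝ
      (WithLp.prodContinuousLinearEquiv 2 ℝ (SpX d) (SpZ d)) v
  obtain ⟨A, hA⟩ : ∃ A : ℝ, ∀ ξ : WithLp 2 (SpX d × SpZ d),
      (1 + ‖ξ‖) ^ (2 * n) * ‖FourierTransform.fourier w ξ‖ ≤ A :=
    ⟨_, fun ξ => by
      simpa using SchwartzMap.one_add_le_sup_seminorm_apply (𝕜 := ℝ) (m := (2 * n, 0))
        le_rfl le_rfl (FourierTransform.fourier w) ξ⟩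
  have hA0 : 0 ≤ A := le_trans (by positivity) (hA 0)
  refine ⟨(2 * Real.pi) ^ (2 * n) * A, by positivity, fun k => ?_⟩
  set ξ : WithLp 2 (SpX d × SpZ d) := (2 * Real.pi)⁻¹ • WithLp.toLp 2 k with hξ
  have hFT : FT d v k = FourierTransform.fourier w ξ := by
    rw [FT_eq_fourier, SchwartzMap.fourier_coe]
    rfl
  have hpi : 1 ≤ 2 * Real.pi := by linarith [Real.pi_gt_three]
  have hnorm : ‖WithLp.toLp 2 k‖ = 2 * Real.pi * ‖ξ‖ := by
    rw [hξ, norm_smul, Real.norm_of_nonneg (by positivity)]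
    field_simp
  have hk1 : ‖k.1‖ ≤ ‖WithLp.toLp 2 k‖ := WithLp.norm_fst_le (p := 2) (x := WithLp.toLp 2 k)
  have hk2 : ‖k.2‖ ≤ ‖WithLp.toLp 2 k‖ := WithLp.norm_snd_le (p := 2) (x := WithLp.toLp 2 k)
  have h1 : 1 + ‖k.1‖ ≤ 2 * Real.pi * (1 + ‖ξ‖) := by linarith
  have h2 : 1 + ‖k.2‖ ≤ 2 * Real.pi * (1 + ‖ξ‖) := by linarith
  rw [hFT, ← mul_inv, ← div_eq_mul_inv, le_div_iff₀ (by positivity)]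
  calc ‖FourierTransform.fourier w ξ‖ * ((1 + ‖k.1‖) ^ n * (1 + ‖k.2‖) ^ n)
      ≤ ‖FourierTransform.fourier w ξ‖ *
        ((2 * Real.pi * (1 + ‖ξ‖)) ^ n * (2 * Real.pi * (1 + ‖ξ‖)) ^ n) := by gcongr
    _ = (2 * Real.pi) ^ (2 * n) * ((1 + ‖ξ‖) ^ (2 * n) * ‖FourierTransform.fourier w ξ‖) := by
      rw [mul_pow]
      ring
    _ ≤ _ := by gcongr; exact hA ξ

/-- The multiplier `a² / (a² + b²)` is bounded by `(a / b) ^ p` for `0 ≤ p ≤ 2`. -/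
theorem sq_div_sq_add_sq_le_rpow {a b p : ℝ} (ha : 0 ≤ a) (hb : 0 < b) (hp0 : 0 ≤ p)
    (hp2 : p ≤ 2) : a ^ 2 / (a ^ 2 + b ^ 2) ≤ a ^ p * b ^ (-p) := by
  rw [Real.rpow_neg hb.le, ← div_eq_mul_inv, ← Real.div_rpow ha hb.le]
  rcases le_total a b with h | h
  · rcases ha.eq_or_lt with rfl | ha
    · simpa using Real.rpow_nonneg (by simp) p
    calc a ^ 2 / (a ^ 2 + b ^ 2) ≤ a ^ 2 / b ^ 2 := by gcongr; nlinarith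
      _ = (a / b) ^ (2 : ℝ) := by rw [Real.rpow_two, div_pow]
      _ ≤ (a / b) ^ p := Real.rpow_le_rpow_of_exponent_ge (by positivity)
          ((div_le_one hb).2 h) hp2
  · calc a ^ 2 / (a ^ 2 + b ^ 2) ≤ 1 := (div_le_one (by positivity)).2 (by nlinarith)
      _ ≤ (a / b) ^ p := Real.one_le_rpow ((one_le_div hb).2 h) hp0

section

variable {E : Type*} [NormedAddCommGroup E] [NormedSpace ℝ E] [FiniteDimensional ℝ E]
  [MeasurableSpace E] [BorelSpace E]

/-- In dimension one the multiplier `a² / (a² + |z|²)` has integral `O(a)`. -/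
theorem exists_lintegral_multiplier_le_of_finrank_eq_one (μ : Measure E) [μ.IsAddHaarMeasure]
    (hE : Module.finrank ℝ E = 1) :
    ∃ K : ℝ, 0 ≤ K ∧ ∀ a : ℝ, 0 ≤ a →
      ∫⁻ z, ENNReal.ofReal (a ^ 2 / (a ^ 2 + ‖z‖ ^ 2)) ∂μ ≤ ENNReal.ofReal (K * a) := by
  have hint : Integrable (fun z : E => (1 + ‖z‖ ^ 2)⁻¹) μ := by
    have h := integrable_rpow_neg_one_add_norm_sq (μ := μ) (E := E) (r := 2) (by simp [hE])
    simpa [Real.rpow_neg_one] using h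
  refine ⟨∫ z, (1 + ‖z‖ ^ 2)⁻¹ ∂μ, integral_nonneg fun z => by positivity, fun a ha => ?_⟩
  rcases ha.eq_or_lt with rfl | ha
  · simp
  have hscale (z : E) : a ^ 2 / (a ^ 2 + ‖z‖ ^ 2) = (1 + ‖a⁻¹ • z‖ ^ 2)⁻¹ := by
    rw [norm_smul, Real.norm_of_nonneg (by positivity)]
    field_simp
  simp_rw [hscale]
  rw [← ofReal_integral_eq_lintegral_ofReal (hint.comp_smul (inv_ne_zero ha.ne'))
    (.of_forall fun z => by positivity),
    Measure.integral_comp_inv_smul_of_nonneg μ (fun z : E => (1 + ‖z‖ ^ 2)⁻¹) ha.le, hE, pow_one,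
    smul_eq_mul, mul_comm]

/-- The weight `|z|^(-p) (1 + |z|)^(-n)` is integrable when `p < dim E < n + p`. -/
theorem integrable_norm_rpow_neg_mul_one_add_norm_pow_inv (μ : Measure E) [μ.IsAddHaarMeasure]
    [Nontrivial E] {p : ℝ} {n : ℕ} (hp : p < Module.finrank ℝ E) (hn : Module.finrank ℝ E < n + p) :
    Integrable (fun z : E => ‖z‖ ^ (-p) * ((1 + ‖z‖) ^ n)⁻¹) μ := by
  rw [integrable_fun_norm_addHaar μ (f := fun r : ℝ => r ^ (-p) * ((1 + r) ^ n)⁻¹)]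
  set D := Module.finrank ℝ E
  have hD : 1 ≤ D := Module.finrank_pos
  have hmeas : Measurable fun y : ℝ => y ^ (D - 1) • (y ^ (-p) * ((1 + y) ^ n)⁻¹) := by fun_prop
  have hpow {y : ℝ} (hy : 0 < y) : y ^ (D - 1) * y ^ (-p) = y ^ ((D : ℝ) - 1 - p) := by
    rw [← Real.rpow_natCast, ← Real.rpow_add hy]
    push_cast [hD]
    ring_nf
  rw [← Ioc_union_Ioi_eq_Ioi (zero_le_one' ℝ)]
  refine IntegrableOn.union ?_ ?_
  · have h := (intervalIntegral.intervalIntegrable_rpow' (a := 0) (b := 1)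
      (r := (D : ℝ) - 1 - p) (by linarith))
    rw [intervalIntegrable_iff_integrableOn_Ioc_of_le zero_le_one] at h
    refine h.mono' hmeas.aestronglyMeasurable ?_
    refine (ae_restrict_iff' measurableSet_Ioc).2 (.of_forall fun y hy => ?_)
    have hy0 : 0 < y := hy.1
    rw [Real.norm_of_nonneg (by positivity), smul_eq_mul, ← mul_assoc, hpow hy0]
    exact mul_le_of_le_one_right (by positivity) (inv_le_one_of_one_le₀ (one_le_pow₀ (by linarith)))
  · have h := integrableOn_Ioi_rpow_of_lt (a := (D : ℝ) - 1 - p - n) (c := 1) (by linarith) one_pos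
    refine h.mono' hmeas.aestronglyMeasurable ?_
    refine (ae_restrict_iff' measurableSet_Ioi).2 (.of_forall fun y hy => ?_)
    have hy0 : 0 < y := one_pos.trans hy
    rw [Real.norm_of_nonneg (by positivity), smul_eq_mul, ← mul_assoc, hpow hy0,
      Real.rpow_sub hy0 _ n, Real.rpow_natCast, div_eq_mul_inv]
    gcongr
    linarith

/-- Above dimension `p`, the multiplier `a² / (a² + |z|²)` has weighted integral `O(a ^ p)`. -/
theorem exists_lintegral_multiplier_mul_le (μ : Measure E) [μ.IsAddHaarMeasure]
    [Nontrivial E] {p : ℝ} {n : ℕ} (hp0 : 0 ≤ p) (hp2 : p ≤ 2) (hp : p < Module.finrank ℝ E)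
    (hn : Module.finrank ℝ E < n + p) :
    ∃ K : ℝ, 0 ≤ K ∧ ∀ a : ℝ, 0 ≤ a →
      ∫⁻ z, ENNReal.ofReal (a ^ 2 / (a ^ 2 + ‖z‖ ^ 2) * ((1 + ‖z‖) ^ n)⁻¹) ∂μ
        ≤ ENNReal.ofReal (K * a ^ p) := by
  have hint := integrable_norm_rpow_neg_mul_one_add_norm_pow_inv μ hp hn
  refine ⟨∫ z, ‖z‖ ^ (-p) * ((1 + ‖z‖) ^ n)⁻¹ ∂μ, integral_nonneg fun z => by positivity,
    fun a ha => ?_⟩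
  rw [mul_comm, ← integral_const_mul,
    ofReal_integral_eq_lintegral_ofReal (hint.const_mul _) (.of_forall fun z => by positivity)]
  refine lintegral_mono_ae ?_
  filter_upwards [Measure.ae_ne μ 0] with z hz
  rw [← mul_assoc]
  gcongr
  exact sq_div_sq_add_sq_le_rpow ha (norm_pos_iff.2 hz) hp0 hp2

end

/-- Let `p = 1` if `d = 1`, and `p ∈ [1,2)` if `d = 2`. For every Schwartz
function `v` there is `C > 0`, independent of `γ`, such that for all `γ ∈ (0,1]`,
`∫ (γ²|k_x|²/(γ²|k_x|² + |k_z|²))·|𝓕v(k_x,k_z)| dk_x dk_z ≤ C γ^p`. -/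
theorem W1_weighted_integral_bound (d : ℕ) (p : ℝ)
    (hp : (d = 1 ∧ p = 1) ∨ (d = 2 ∧ 1 ≤ p ∧ p < 2))
    (v : SchwartzMap (SpX d × SpZ d) ℂ) :
    ∃ C > (0 : ℝ), ∀ γ : ℝ, 0 < γ → γ ≤ 1 →
      (∫⁻ k : SpX d × SpZ d,
          ENNReal.ofReal
            (γ ^ 2 * ‖k.1‖ ^ 2 / (γ ^ 2 * ‖k.1‖ ^ 2 + ‖k.2‖ ^ 2) *
              ‖FT d v k‖)) ≤ ENNReal.ofReal (C * γ ^ p) := by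
  have hK : ∃ K : ℝ, 0 ≤ K ∧ ∀ a : ℝ, 0 ≤ a →
      ∫⁻ z : SpZ d, ENNReal.ofReal (a ^ 2 / (a ^ 2 + ‖z‖ ^ 2) * ((1 + ‖z‖) ^ 4)⁻¹)
        ≤ ENNReal.ofReal (K * a ^ p) := by
    rcases hp with ⟨rfl, rfl⟩ | ⟨rfl, hp1, hp2⟩
    · obtain ⟨K, hK0, hK⟩ := exists_lintegral_multiplier_le_of_finrank_eq_one
        (volume : Measure (SpZ 1)) (by simp)
      refine ⟨K, hK0, fun a ha => le_trans (lintegral_mono fun z => ?_) ((hK a ha).trans (by simp))⟩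
      exact ENNReal.ofReal_le_ofReal (mul_le_of_le_one_right (by positivity)
        (inv_le_one_of_one_le₀ (one_le_pow₀ (by linarith [norm_nonneg z]))))
    · refine exists_lintegral_multiplier_mul_le _ (by linarith) hp2.le (by simpa using hp2) ?_
      simp only [finrank_euclideanSpace, Fintype.card_fin, Nat.cast_ofNat]
      linarith
  have hp0 : 0 ≤ p := by rcases hp with ⟨-, h⟩ | ⟨-, h, -⟩ <;> linarith
  have hJ : Integrable (fun x : SpX d => (1 + ‖x‖) ^ (-(4 - p))) := by
    refine integrable_one_add_norm ?_
    rcases hp with ⟨rfl, rfl⟩ | ⟨rfl, hp1, hp2⟩ <;> norm_num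
    linarith
  obtain ⟨K, hK0, hK⟩ := hK
  obtain ⟨A, hA0, hA⟩ := exists_norm_FT_le d 4 v
  set J := ∫ x : SpX d, (1 + ‖x‖) ^ (-(4 - p))
  have hJ0 : 0 ≤ J := integral_nonneg fun x => by positivity
  refine ⟨A * K * J + 1, by positivity, fun γ hγ _ => ?_⟩
  calc
    _ ≤ ∫⁻ k : SpX d × SpZ d, ENNReal.ofReal (A * ((1 + ‖k.1‖) ^ 4)⁻¹) * ENNReal.ofReal
          ((γ * ‖k.1‖) ^ 2 / ((γ * ‖k.1‖) ^ 2 + ‖k.2‖ ^ 2) * ((1 + ‖k.2‖) ^ 4)⁻¹) := by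
      refine lintegral_mono fun k => ?_
      rw [← ENNReal.ofReal_mul (by positivity), mul_pow]
      refine ENNReal.ofReal_le_ofReal ?_
      refine (mul_le_mul_of_nonneg_left (hA k) (by positivity)).trans_eq ?_
      ring
    _ = ∫⁻ x : SpX d, ENNReal.ofReal (A * ((1 + ‖x‖) ^ 4)⁻¹) * ∫⁻ z : SpZ d, ENNReal.ofReal
          ((γ * ‖x‖) ^ 2 / ((γ * ‖x‖) ^ 2 + ‖z‖ ^ 2) * ((1 + ‖z‖) ^ 4)⁻¹) := by
      rw [Measure.volume_eq_prod, lintegral_prod _ (by fun_prop)]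
      congr 1 with x
      dsimp only
      rw [lintegral_const_mul _ (by fun_prop)]
    _ ≤ ∫⁻ x : SpX d, ENNReal.ofReal (A * K * γ ^ p * (1 + ‖x‖) ^ (-(4 - p))) := by
      refine lintegral_mono fun x => (mul_le_mul_right (hK _ (by positivity)) _).trans ?_
      rw [← ENNReal.ofReal_mul (by positivity), Real.mul_rpow hγ.le (norm_nonneg x)]
      refine ENNReal.ofReal_le_ofReal ?_
      have h : (1 + ‖x‖) ^ (-(4 - p)) = ((1 + ‖x‖) ^ 4)⁻¹ * (1 + ‖x‖) ^ p := by
        rw [neg_sub, Real.rpow_sub (by positivity), div_eq_inv_mul]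
        norm_cast
      calc A * ((1 + ‖x‖) ^ 4)⁻¹ * (K * (γ ^ p * ‖x‖ ^ p))
          ≤ A * ((1 + ‖x‖) ^ 4)⁻¹ * (K * (γ ^ p * (1 + ‖x‖) ^ p)) := by gcongr; linarith
        _ = _ := by rw [h]; ring
    _ = ENNReal.ofReal (A * K * γ ^ p * J) := by
      rw [← ofReal_integral_eq_lintegral_ofReal (hJ.const_mul _)
        (.of_forall fun x => by positivity), integral_const_mul]
    _ ≤ _ := by
      refine ENNReal.ofReal_le_ofReal ?_
      have := Real.rpow_nonneg hγ.le p
      linarith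
end
end

section
/- Let d ∈ {1,2}, let v be a complex-valued Schwartz function on ℝ^{3-d} × ℝ^d, and let q ∈ (0,1). Then there exists a constant C > 0 (depending on v, d and q but not on γ) such that for all γ ∈ (0,1]: ∫_{ℝ^{3-d} × ℝ^d} (γ|k_x||k_z| / (γ²|k_x|² + |k_z|²)) · |𝓕v(k_x,k_z)| dk_x dk_z ≤ C γ^q. -/
open MeasureTheory Set
open scoped RealInnerProductSpace ENNReal

noncomputable section

/-- The Euclidean inner product on `ℝ^{3-d} × ℝ^d` as a continuous bilinear form. -/
def prodInner (d : ℕ) : (SpX d × SpZ d) →L[ℝ] (SpX d × SpZ d) →L[ℝ] ℝ :=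
  (innerSL ℝ (E := SpX d)).bilinearComp (.fst ℝ _ _) (.fst ℝ _ _) +
    (innerSL ℝ (E := SpZ d)).bilinearComp (.snd ℝ _ _) (.snd ℝ _ _)

lemma prodInner_apply (d : ℕ) (x k : SpX d × SpZ d) :
    prodInner d x k = ⟪x.1, k.1⟫ + ⟪x.2, k.2⟫ := by
  simp [prodInner]

lemma norm_sq_le_prodInner_self (d : ℕ) (k : SpX d × SpZ d) : ‖k‖ ^ 2 ≤ prodInner d k k := by
  rw [prodInner_apply, real_inner_self_eq_norm_sq, real_inner_self_eq_norm_sq, Prod.norm_def]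
  rcases max_choice ‖k.1‖ ‖k.2‖ with h | h <;> rw [h] <;>
    nlinarith [sq_nonneg ‖k.1‖, sq_nonneg ‖k.2‖]

lemma FT_eq_fourierIntegral (d : ℕ) (u : SpX d × SpZ d → ℂ) (k : SpX d × SpZ d) :
    FT d u k = VectorFourier.fourierIntegral Real.fourierChar volume (prodInner d).toLinearMap₁₂ u
      ((2 * Real.pi)⁻¹ • k) := by
  unfold FT VectorFourier.fourierIntegral
  congr 1 with x
  rw [Circle.smul_def, Real.fourierChar_apply, smul_eq_mul]
  congr 2
  have h : ((prodInner d).toLinearMap₁₂ x) ((2 * Real.pi)⁻¹ • k)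
      = (2 * Real.pi)⁻¹ * (⟪k.1, x.1⟫ + ⟪k.2, x.2⟫) := by
    change prodInner d x ((2 * Real.pi)⁻¹ • k) = _
    rw [map_smul, prodInner_apply, smul_eq_mul, real_inner_comm, real_inner_comm k.2]
  rw [h, mul_neg, mul_inv_cancel_left₀ (by positivity)]
  push_cast
  ring

lemma exists_norm_pow_mul_FT_le (d : ℕ) (v : SchwartzMap (SpX d × SpZ d) ℂ) (n : ℕ) :
    ∃ C : ℝ, 0 ≤ C ∧ ∀ k, ‖k‖ ^ n * ‖FT d v k‖ ≤ C := by
  have : (volume : Measure (SpX d × SpZ d)).IsAddHaarMeasure :=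
    inferInstanceAs ((volume : Measure (SpX d)).prod (volume : Measure (SpZ d))).IsAddHaarMeasure
  obtain ⟨S, hS0, hS⟩ : ∃ S : ℝ, 0 ≤ S ∧ ∀ w : SpX d × SpZ d, |prodInner d w w| ^ n *
      ‖VectorFourier.fourierIntegral Real.fourierChar volume (prodInner d).toLinearMap₁₂ v w‖
        ≤ ‖w‖ ^ n * S := by
    refine ⟨2 ^ n * ∑ p ∈ Finset.range (0 + 1) ×ˢ Finset.range (n + 1),
      ∫ x, ‖x‖ ^ p.1 * ‖iteratedFDeriv ℝ p.2 v x‖, by positivity, fun w => ?_⟩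
    have h := VectorFourier.pow_mul_norm_iteratedFDeriv_fourierIntegral_le (prodInner d)
      (μ := volume) (K := ⊤) (N := ⊤) (v.smooth ⊤)
      (fun k n _ _ => v.integrable_pow_mul_iteratedFDeriv volume k n)
      (k := 0) (n := n) le_top le_top w w
    simpa [mul_assoc] using h
  refine ⟨(2 * Real.pi) ^ n * max S
    ‖VectorFourier.fourierIntegral Real.fourierChar volume (prodInner d).toLinearMap₁₂ v 0‖,
    by positivity, fun k => ?_⟩
  rw [FT_eq_fourierIntegral]
  set w := (2 * Real.pi)⁻¹ • k with hw
  have hk : ‖k‖ = 2 * Real.pi * ‖w‖ := by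
    rw [hw, norm_smul, Real.norm_of_nonneg (by positivity), mul_inv_cancel_left₀ (by positivity)]
  rw [hk, mul_pow, mul_assoc]
  gcongr
  rcases eq_or_ne w 0 with h0 | h0
  · rw [h0, norm_zero]
    refine le_max_of_le_right (mul_le_of_le_one_left (norm_nonneg _) ?_)
    exact pow_le_one₀ le_rfl zero_le_one
  · refine le_max_of_le_left (le_of_mul_le_mul_left ?_ (pow_pos (norm_pos_iff.2 h0) n))
    refine le_trans ?_ (hS w)
    rw [← mul_assoc, ← mul_pow, ← sq]
    gcongr
    exact (norm_sq_le_prodInner_self d w).trans (le_abs_self _)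

lemma exists_one_add_norm_pow_mul_FT_le (d : ℕ) (v : SchwartzMap (SpX d × SpZ d) ℂ) (n : ℕ) :
    ∃ C : ℝ, 0 ≤ C ∧ ∀ k, (1 + ‖k‖) ^ n * ‖FT d v k‖ ≤ C := by
  obtain ⟨A, hA, h⟩ := exists_norm_pow_mul_FT_le d v 0
  obtain ⟨B, hB, h'⟩ := exists_norm_pow_mul_FT_le d v n
  refine ⟨2 ^ (n - 1) * (A + B), by positivity, fun k => ?_⟩
  calc (1 + ‖k‖) ^ n * ‖FT d v k‖
      ≤ 2 ^ (n - 1) * (1 ^ n + ‖k‖ ^ n) * ‖FT d v k‖ := by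
        gcongr
        exact add_pow_le zero_le_one (norm_nonneg k) n
    _ = 2 ^ (n - 1) * (‖k‖ ^ 0 * ‖FT d v k‖ + ‖k‖ ^ n * ‖FT d v k‖) := by ring
    _ ≤ _ := by gcongr <;> [exact h k; exact h' k]

lemma div_one_add_sq_le_rpow {t q : ℝ} (ht : 0 ≤ t) (hq0 : 0 ≤ q) (hq1 : q ≤ 1) :
    t / (t ^ 2 + 1) ≤ t ^ q := by
  rw [div_le_iff₀ (by positivity)]
  have hq := Real.rpow_nonneg ht q
  rcases le_total t 1 with h | h
  · have := Real.rpow_le_rpow_of_exponent_ge' ht h hq0 hq1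
    rw [Real.rpow_one] at this
    nlinarith [sq_nonneg t]
  · nlinarith [Real.one_le_rpow h hq0]

lemma mul_div_sq_add_sq_le {a b q : ℝ} (ha : 0 ≤ a) (hb : 0 ≤ b) (hq0 : 0 ≤ q) (hq1 : q ≤ 1) :
    a * b / (a ^ 2 + b ^ 2) ≤ a ^ q * b ^ (-q) := by
  rcases hb.eq_or_lt with rfl | hb'
  · rw [mul_zero, zero_div]
    positivity
  · have h := div_one_add_sq_le_rpow (div_nonneg ha hb) hq0 hq1
    rw [Real.div_rpow ha hb] at h
    rw [Real.rpow_neg hb, ← div_eq_mul_inv]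
    convert h using 1
    field_simp

lemma integrable_norm_rpow_neg_mul_one_add_norm {E : Type*} [NormedAddCommGroup E]
    [NormedSpace ℝ E] [FiniteDimensional ℝ E] [MeasurableSpace E] [BorelSpace E] [Nontrivial E]
    (μ : Measure E) [μ.IsAddHaarMeasure] {q r : ℝ} (hq0 : 0 ≤ q) (hq1 : q < 1)
    (hr : Module.finrank ℝ E < r) :
    Integrable (fun x : E => ‖x‖ ^ (-q) * (1 + ‖x‖) ^ (-r)) μ := by
  have hd : 1 ≤ Module.finrank ℝ E := Module.finrank_pos
  have hd' : ((Module.finrank ℝ E - 1 : ℕ) : ℝ) = Module.finrank ℝ E - 1 := by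
    push_cast [hd]; rfl
  rw [integrable_fun_norm_addHaar μ (f := fun y : ℝ => y ^ (-q) * (1 + y) ^ (-r)),
    ← Ioc_union_Ioi_eq_Ioi zero_le_one]
  have hr0 : 0 ≤ r := le_trans (Nat.cast_nonneg _) hr.le
  refine IntegrableOn.union ?_ ?_
  · have hi : IntegrableOn (fun y : ℝ => y ^ (-q)) (Ioc 0 1) :=
      (intervalIntegrable_iff_integrableOn_Ioc_of_le zero_le_one).1
        (intervalIntegral.intervalIntegrable_rpow' (by linarith))
    refine hi.mono' (by fun_prop) ?_
    filter_upwards [ae_restrict_mem measurableSet_Ioc] with y hy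
    have hy0 := hy.1
    rw [Real.norm_of_nonneg (by simp only [smul_eq_mul]; positivity), smul_eq_mul,
      mul_left_comm]
    refine mul_le_of_le_one_right (by positivity) (mul_le_one₀ ?_ (by positivity) ?_)
    · exact pow_le_one₀ hy0.le hy.2
    · exact Real.rpow_le_one_of_one_le_of_nonpos (by linarith) (by linarith)
  · have hi : IntegrableOn (fun y : ℝ => y ^ ((Module.finrank ℝ E : ℝ) - 1 - r)) (Ioi 1) :=
      integrableOn_Ioi_rpow_of_lt (by linarith) zero_lt_one
    refine hi.mono' (by fun_prop) ?_
    filter_upwards [ae_restrict_mem measurableSet_Ioi] with y (hy : 1 < y)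
    have hy0 : 0 < y := zero_lt_one.trans hy
    rw [Real.norm_of_nonneg (by simp only [smul_eq_mul]; positivity), smul_eq_mul,
      sub_eq_add_neg, Real.rpow_add hy0, ← hd', Real.rpow_natCast]
    gcongr
    exact (mul_le_of_le_one_left (by positivity)
      (Real.rpow_le_one_of_one_le_of_nonpos hy.le (by linarith))).trans
      (Real.rpow_le_rpow_of_nonpos hy0 (by linarith) (by linarith))

/-- For `d ∈ {1,2}`, a Schwartz function `v` and `q ∈ (0,1)`, there is `C > 0`,
independent of `γ`, such that for all `γ ∈ (0,1]`,
`∫ (γ|k_x||k_z|/(γ²|k_x|² + |k_z|²))·|𝓕v(k_x,k_z)| dk_x dk_z ≤ C γ^q`. -/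
theorem W2_weighted_integral_bound (d : ℕ) (hd : d = 1 ∨ d = 2) (q : ℝ)
    (hq : 0 < q ∧ q < 1) (v : SchwartzMap (SpX d × SpZ d) ℂ) :
    ∃ C > (0 : ℝ), ∀ γ : ℝ, 0 < γ → γ ≤ 1 →
      (∫⁻ k : SpX d × SpZ d,
          ENNReal.ofReal
            (γ * ‖k.1‖ * ‖k.2‖ / (γ ^ 2 * ‖k.1‖ ^ 2 + ‖k.2‖ ^ 2) *
              ‖FT d v k‖)) ≤ ENNReal.ofReal (C * γ ^ q) := by
  obtain ⟨hq0, hq1⟩ := hq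
  obtain ⟨C, hC, hFT⟩ := exists_one_add_norm_pow_mul_FT_le d v 7
  have : Nontrivial (SpZ d) := by
    rcases hd with rfl | rfl <;> infer_instance
  have hX : Integrable (fun x : SpX d => (1 + ‖x‖) ^ (-3 : ℝ)) := by
    refine integrable_one_add_norm ?_
    rcases hd with rfl | rfl <;> norm_num
  have hZ : Integrable (fun z : SpZ d => ‖z‖ ^ (-q) * (1 + ‖z‖) ^ (-3 : ℝ)) := by
    refine integrable_norm_rpow_neg_mul_one_add_norm volume hq0.le hq1 ?_
    rcases hd with rfl | rfl <;> norm_num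
  have hXZ : Integrable (fun k : SpX d × SpZ d =>
      (1 + ‖k.1‖) ^ (-3 : ℝ) * (‖k.2‖ ^ (-q) * (1 + ‖k.2‖) ^ (-3 : ℝ))) := hX.mul_prod hZ
  set I := ∫ k : SpX d × SpZ d,
    (1 + ‖k.1‖) ^ (-3 : ℝ) * (‖k.2‖ ^ (-q) * (1 + ‖k.2‖) ^ (-3 : ℝ)) with hI
  have hI0 : 0 ≤ I := integral_nonneg fun k => by positivity
  refine ⟨C * I + 1, by positivity, fun γ hγ _ => ?_⟩
  have hpt (k : SpX d × SpZ d) :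
      γ * ‖k.1‖ * ‖k.2‖ / (γ ^ 2 * ‖k.1‖ ^ 2 + ‖k.2‖ ^ 2) * ‖FT d v k‖ ≤
        γ ^ q * C * ((1 + ‖k.1‖) ^ (-3 : ℝ) * (‖k.2‖ ^ (-q) * (1 + ‖k.2‖) ^ (-3 : ℝ))) := by
    have hmult := mul_div_sq_add_sq_le (a := γ * ‖k.1‖) (by positivity) (norm_nonneg k.2)
      hq0.le hq1.le
    rw [mul_pow, Real.mul_rpow hγ.le (norm_nonneg _)] at hmult
    have hxq : ‖k.1‖ ^ q ≤ 1 + ‖k.1‖ :=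
      (Real.rpow_le_rpow (norm_nonneg _) (by linarith) hq0.le).trans
        (Real.rpow_le_self_of_one_le (by linarith [norm_nonneg k.1]) hq1.le)
    have hdecay : (1 + ‖k.1‖) * ‖FT d v k‖ ≤
        C * ((1 + ‖k.1‖) ^ (-3 : ℝ) * (1 + ‖k.2‖) ^ (-3 : ℝ)) := by
      rw [Real.rpow_neg (by positivity), Real.rpow_neg (by positivity), ← mul_inv,
        ← div_eq_mul_inv, le_div_iff₀ (by positivity)]
      refine le_trans ?_ (hFT k)
      norm_cast
      calc (1 + ‖k.1‖) * ‖FT d v k‖ * ((1 + ‖k.1‖) ^ 3 * (1 + ‖k.2‖) ^ 3)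
          = (1 + ‖k.1‖) ^ 4 * (1 + ‖k.2‖) ^ 3 * ‖FT d v k‖ := by ring
        _ ≤ (1 + ‖k‖) ^ 4 * (1 + ‖k‖) ^ 3 * ‖FT d v k‖ := by
          gcongr
          · exact norm_fst_le k
          · exact norm_snd_le k
        _ = _ := by ring
    calc _ ≤ γ ^ q * ‖k.1‖ ^ q * ‖k.2‖ ^ (-q) * ‖FT d v k‖ := by gcongr
      _ ≤ γ ^ q * (1 + ‖k.1‖) * ‖k.2‖ ^ (-q) * ‖FT d v k‖ := by gcongr
      _ = γ ^ q * ‖k.2‖ ^ (-q) * ((1 + ‖k.1‖) * ‖FT d v k‖) := by ring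
      _ ≤ γ ^ q * ‖k.2‖ ^ (-q) *
          (C * ((1 + ‖k.1‖) ^ (-3 : ℝ) * (1 + ‖k.2‖) ^ (-3 : ℝ))) := by gcongr
      _ = _ := by ring
  refine (lintegral_mono fun k => ENNReal.ofReal_le_ofReal (hpt k)).trans ?_
  rw [← ofReal_integral_eq_lintegral_ofReal (hXZ.const_mul _)
    (Filter.Eventually.of_forall fun k => by positivity), integral_const_mul, ← hI]
  refine ENNReal.ofReal_le_ofReal ?_
  nlinarith [Real.rpow_nonneg hγ.le q]
end
end

section
/- Let d ∈ {1,2}, let n = (n_x,n_z) ∈ ℝ^{3-d} × ℝ^d be a unit vector, let v be a complex-valued Schwartz function on ℝ^{3-d} × ℝ^d, and let q ∈ (0,1). Then there exists a constant C > 0 (depending on v, n, d and q but not on γ) such that for all γ ∈ (0,1] and all (x,z) ∈ ℝ^{3-d} × ℝ^d: |𝓕⁻¹[(m_γ - m_0)·𝓕v](x,z)| ≤ C γ^q. Equivalently, the convolution differences V^γ_dip * v - V^0_dip * v converge to zero in L^∞ at rate γ^q for every q < 1. -/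
open MeasureTheory Set
open scoped RealInnerProductSpace ENNReal

noncomputable section

/-- The inverse Fourier transform
`𝓕⁻¹g(x) = (2π)⁻³ ∫ g(k) e^{i k·x} dk` on `ℝ^{3-d} × ℝ^d` (total dimension `3`). -/
def invFT (d : ℕ) (g : SpX d × SpZ d → ℂ) (x : SpX d × SpZ d) : ℂ :=
  (((2 * Real.pi) ^ 3 : ℝ) : ℂ)⁻¹ *
    ∫ k : SpX d × SpZ d,
      Complex.exp (Complex.I * ((⟪k.1, x.1⟫ + ⟪k.2, x.2⟫ : ℝ) : ℂ)) * g k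

/-- The dipolar Fourier multiplier
`m_γ(k_x,k_z) = -1/3 + (γ k_x·n_x + k_z·n_z)² / (γ²|k_x|² + |k_z|²)`
(it takes the default value `-1/3` when the denominator vanishes). -/
def mdip (d : ℕ) (nx : SpX d) (nz : SpZ d) (γ : ℝ) (k : SpX d × SpZ d) : ℝ :=
  -1/3 + (γ * ⟪k.1, nx⟫ + ⟪k.2, nz⟫) ^ 2 / (γ ^ 2 * ‖k.1‖ ^ 2 + ‖k.2‖ ^ 2)

/-- The Fourier transform of a Schwartz function on `ℝ^{3-d} × ℝ^d` is a Schwartz function. -/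
theorem exists_schwartzMap_eq_FT (d : ℕ) (v : SchwartzMap (SpX d × SpZ d) ℂ) :
    ∃ g : SchwartzMap (SpX d × SpZ d) ℂ, ∀ k, FT d v k = g k := by
  let e := WithLp.prodContinuousLinearEquiv 2 ℝ (SpX d) (SpZ d)
  let c : (SpX d × SpZ d) ≃L[ℝ] (SpX d × SpZ d) :=
    ContinuousLinearEquiv.smulLeft
      (Units.mk0 ((2 * Real.pi)⁻¹ : ℝ) (inv_ne_zero Real.two_pi_pos.ne'))
  let w : SchwartzMap (WithLp 2 (SpX d × SpZ d)) ℂ :=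
    SchwartzMap.compCLMOfContinuousLinearEquiv ℂ e v
  refine ⟨SchwartzMap.compCLMOfContinuousLinearEquiv ℂ (c.trans e.symm)
    (FourierTransform.fourier w), fun k => ?_⟩
  rw [SchwartzMap.compCLMOfContinuousLinearEquiv_apply, Function.comp_apply,
    SchwartzMap.fourier_coe, Real.fourier_eq', FT,
    ← (WithLp.volume_preserving_ofLp (SpX d) (SpZ d)).integral_comp
      (MeasurableEquiv.toLp 2 (SpX d × SpZ d)).symm.measurableEmbedding]
  refine integral_congr_ae (Filter.Eventually.of_forall fun x => ?_)
  have hk : (c.trans e.symm) k = WithLp.toLp 2 ((2 * Real.pi)⁻¹ • k) := rfl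
  have hw : w x = v x.ofLp := rfl
  have hpi : -2 * Real.pi * ((2 * Real.pi)⁻¹ * ⟪k.1, x.ofLp.1⟫ + (2 * Real.pi)⁻¹ * ⟪k.2, x.ofLp.2⟫)
      = -(⟪k.1, x.ofLp.1⟫ + ⟪k.2, x.ofLp.2⟫) := by
    field_simp
  simp only [hk, hw, WithLp.prod_inner_apply, smul_eq_mul, Prod.smul_fst, Prod.smul_snd,
    inner_smul_right, real_inner_comm]
  congr 2
  rw [hpi]
  push_cast
  ring

theorem SchwartzMap.exists_norm_le_mul_rpow_neg {E F : Type*} [NormedAddCommGroup E]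
    [NormedSpace ℝ E] [NormedAddCommGroup F] [NormedSpace ℝ F] (g : SchwartzMap E F) (m : ℕ) :
    ∃ D, 0 ≤ D ∧ ∀ x, ‖g x‖ ≤ D * (1 + ‖x‖) ^ (-m : ℝ) := by
  refine ⟨2 ^ m * (Finset.Iic (m, 0)).sup (fun m => SchwartzMap.seminorm ℝ m.1 m.2) g,
    by positivity, fun x => ?_⟩
  have h := SchwartzMap.one_add_le_sup_seminorm_apply (𝕜 := ℝ) (m := (m, 0)) le_rfl le_rfl g x
  rw [norm_iteratedFDeriv_zero] at h
  rw [Real.rpow_neg (by positivity), Real.rpow_natCast, ← div_eq_mul_inv,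
    le_div_iff₀ (by positivity), mul_comm]
  exact h

theorem one_add_norm_prod_rpow_neg_le {E F : Type*} [NormedAddCommGroup E]
    [NormedAddCommGroup F] {r : ℝ} (hr : 0 ≤ r) (x : E × F) :
    (1 + ‖x‖) ^ (-(2 * r)) ≤ (1 + ‖x.1‖) ^ (-r) * (1 + ‖x.2‖) ^ (-r) := by
  rw [neg_mul_eq_mul_neg, Real.rpow_mul (by positivity), Real.rpow_two,
    ← Real.mul_rpow (by positivity) (by positivity)]
  refine Real.rpow_le_rpow_of_nonpos (by positivity) ?_ (by linarith)
  rw [sq]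
  gcongr
  exacts [norm_fst_le x, norm_snd_le x]

theorem integrable_norm_rpow_mul_one_add_norm_rpow_neg {E : Type*} [NormedAddCommGroup E]
    [NormedSpace ℝ E] [FiniteDimensional ℝ E] [MeasurableSpace E] [BorelSpace E]
    (μ : Measure E) [μ.IsAddHaarMeasure] {q r : ℝ} (hq : 0 ≤ q)
    (hr : Module.finrank ℝ E + q < r) :
    Integrable (fun x : E => ‖x‖ ^ q * (1 + ‖x‖) ^ (-r)) μ := by
  refine (integrable_one_add_norm (μ := μ) (r := r - q) (by linarith)).mono'
    (by fun_prop) (Filter.Eventually.of_forall fun x => ?_)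
  rw [Real.norm_of_nonneg (by positivity), show -(r - q) = q + -r by ring,
    Real.rpow_add (by positivity)]
  gcongr
  linarith

theorem integrable_norm_rpow_neg_mul_one_add_norm_rpow_neg {E : Type*} [NormedAddCommGroup E]
    [NormedSpace ℝ E] [FiniteDimensional ℝ E] [Nontrivial E] [MeasurableSpace E] [BorelSpace E]
    (μ : Measure E) [μ.IsAddHaarMeasure] {q r : ℝ} (hq₀ : 0 ≤ q)
    (hq : q < Module.finrank ℝ E) (hr : Module.finrank ℝ E < r) :
    Integrable (fun x : E => ‖x‖ ^ (-q) * (1 + ‖x‖) ^ (-r)) μ := by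
  have hr₀ : 0 < r := (Nat.cast_nonneg _).trans_lt hr
  have hball : IntegrableOn (fun x : E => ‖x‖ ^ (-q)) (Metric.ball 0 1) μ := by
    rw [integrableOn_fun_norm_addHaar μ (f := fun y : ℝ => y ^ (-q))]
    have hdim : 1 ≤ Module.finrank ℝ E := Module.finrank_pos
    refine ((intervalIntegral.integrableOn_Ioo_rpow_iff (s := (Module.finrank ℝ E - 1 : ℕ) + -q)
      one_pos).2 ?_).congr_fun ?_ measurableSet_Ioo
    · push_cast [hdim]
      linarith
    · intro y hy
      simp only [smul_eq_mul]
      rw [Real.rpow_add hy.1, Real.rpow_natCast]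
  refine ((hball.integrable_indicator measurableSet_ball).add
    (integrable_one_add_norm (μ := μ) hr)).mono' (by fun_prop)
    (Filter.Eventually.of_forall fun x => ?_)
  rw [Real.norm_of_nonneg (by positivity), Pi.add_apply]
  by_cases hx : x ∈ Metric.ball (0 : E) 1
  · rw [indicator_of_mem hx]
    have h₁ : (1 + ‖x‖) ^ (-r) ≤ 1 :=
      Real.rpow_le_one_of_one_le_of_nonpos (by linarith [norm_nonneg x]) (by linarith)
    have h₂ : 0 ≤ ‖x‖ ^ (-q) := by positivity
    have h₃ : 0 ≤ (1 + ‖x‖) ^ (-r) := by positivity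
    nlinarith
  · rw [indicator_of_notMem hx, zero_add]
    have hx₁ : 1 ≤ ‖x‖ := by simpa using hx
    exact mul_le_of_le_one_left (by positivity)
      (Real.rpow_le_one_of_one_le_of_nonpos hx₁ (by linarith))

theorem abs_add_sq_div_sub_sq_div_le {a b A B : ℝ} (hA : 0 ≤ A) (hB : 0 < B) (ha : |a| ≤ A)
    (hb : |b| ≤ B) :
    |(a + b) ^ 2 / (A ^ 2 + B ^ 2) - b ^ 2 / B ^ 2| ≤ 2 * (A ^ 2 + A * B) / (A ^ 2 + B ^ 2) := by
  have hAB : 0 < A ^ 2 + B ^ 2 := by positivity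
  have ha' : a ^ 2 ≤ A ^ 2 := sq_le_sq' (abs_le.1 ha).1 (abs_le.1 ha).2
  have hab : |a * b| ≤ A * B := by
    rw [abs_mul]
    gcongr
  have hb' : b ^ 2 / B ^ 2 ≤ 1 := by
    rw [div_le_one (by positivity)]
    exact sq_le_sq' (abs_le.1 hb).1 (abs_le.1 hb).2
  have hb₀ : 0 ≤ b ^ 2 / B ^ 2 := by positivity
  have key : (a + b) ^ 2 / (A ^ 2 + B ^ 2) - b ^ 2 / B ^ 2
      = (a ^ 2 + 2 * (a * b) - b ^ 2 / B ^ 2 * A ^ 2) / (A ^ 2 + B ^ 2) := by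
    field_simp
    ring
  rw [key, abs_div, abs_of_pos hAB]
  gcongr
  rw [abs_le] at hab ⊢
  constructor <;> nlinarith [sq_nonneg a, sq_nonneg A]

theorem sq_add_mul_div_le_rpow {A B q : ℝ} (hA : 0 ≤ A) (hB : 0 < B) (hq₀ : 0 ≤ q) (hq₁ : q ≤ 1) :
    2 * (A ^ 2 + A * B) / (A ^ 2 + B ^ 2) ≤ 4 * (A / B) ^ q := by
  rcases le_total 1 (A / B) with h | h
  · calc 2 * (A ^ 2 + A * B) / (A ^ 2 + B ^ 2) ≤ 4 * 1 := by
          rw [div_le_iff₀ (by positivity)]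
          nlinarith [sq_nonneg (A - B), sq_nonneg A, sq_nonneg B]
      _ ≤ 4 * (A / B) ^ q := by
          gcongr
          exact Real.one_le_rpow h hq₀
  · calc 2 * (A ^ 2 + A * B) / (A ^ 2 + B ^ 2) ≤ 4 * (A / B) := by
          have hAB : A ≤ B := (div_le_one hB).1 h
          rw [mul_div_assoc', div_le_div_iff₀ (by positivity) hB]
          nlinarith [mul_nonneg (mul_nonneg hA hB.le) (sub_nonneg.2 hAB), pow_nonneg hA 3]
      _ ≤ 4 * (A / B) ^ q := by
          gcongr
          exact Real.self_le_rpow_of_le_one (by positivity) h hq₁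

theorem abs_mdip_sub_mdip_zero_le (d : ℕ) {nx : SpX d} {nz : SpZ d} (hnx : ‖nx‖ ≤ 1)
    (hnz : ‖nz‖ ≤ 1) {q γ : ℝ} (hq₀ : 0 ≤ q) (hq₁ : q ≤ 1) (hγ : 0 ≤ γ) (k : SpX d × SpZ d)
    (hk : k.2 ≠ 0) :
    |mdip d nx nz γ k - mdip d nx nz 0 k| ≤ 4 * γ ^ q * (‖k.1‖ ^ q * ‖k.2‖ ^ (-q)) := by
  have hB : 0 < ‖k.2‖ := norm_pos_iff.2 hk
  have ha : |γ * ⟪k.1, nx⟫| ≤ γ * ‖k.1‖ := by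
    rw [abs_mul, abs_of_nonneg hγ]
    gcongr
    exact (abs_real_inner_le_norm _ _).trans (mul_le_of_le_one_right (norm_nonneg _) hnx)
  have hb : |⟪k.2, nz⟫| ≤ ‖k.2‖ :=
    (abs_real_inner_le_norm _ _).trans (mul_le_of_le_one_right (norm_nonneg _) hnz)
  have h := (abs_add_sq_div_sub_sq_div_le (by positivity) hB ha hb).trans
    (sq_add_mul_div_le_rpow (by positivity) hB hq₀ hq₁)
  rw [Real.div_rpow (by positivity) hB.le, Real.mul_rpow hγ (norm_nonneg _)] at h
  have hm : mdip d nx nz γ k - mdip d nx nz 0 k = (γ * ⟪k.1, nx⟫ + ⟪k.2, nz⟫) ^ 2 /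
      ((γ * ‖k.1‖) ^ 2 + ‖k.2‖ ^ 2) - ⟪k.2, nz⟫ ^ 2 / ‖k.2‖ ^ 2 := by
    simp [mdip, mul_pow]
  rw [hm]
  refine h.trans_eq ?_
  rw [Real.rpow_neg hB.le]
  ring

/-- For `d ∈ {1,2}`, a unit vector `n = (n_x,n_z)`, a Schwartz function `v` and
`q ∈ (0,1)`, there is `C > 0`, independent of `γ`, such that for all `γ ∈ (0,1]`
and all `(x,z)`, `|𝓕⁻¹[(m_γ - m_0)·𝓕v](x,z)| ≤ C γ^q`. -/
theorem dipolar_convolution_difference_Linfty_bound (d : ℕ) (hd : d = 1 ∨ d = 2)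
    (nx : SpX d) (nz : SpZ d) (hn : ‖nx‖ ^ 2 + ‖nz‖ ^ 2 = 1)
    (q : ℝ) (hq : 0 < q ∧ q < 1) (v : SchwartzMap (SpX d × SpZ d) ℂ) :
    ∃ C > (0 : ℝ), ∀ γ : ℝ, 0 < γ → γ ≤ 1 → ∀ x : SpX d × SpZ d,
      ‖invFT d
          (fun k => ((mdip d nx nz γ k - mdip d nx nz 0 k : ℝ) : ℂ) * FT d v k)
          x‖ ≤ C * γ ^ q := by
  have hd₀ : 0 < d := by omega
  have : Nonempty (Fin d) := ⟨⟨0, hd₀⟩⟩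
  have hnx : ‖nx‖ ≤ 1 := by nlinarith [sq_nonneg ‖nz‖, norm_nonneg nx]
  have hnz : ‖nz‖ ≤ 1 := by nlinarith [sq_nonneg ‖nx‖, norm_nonneg nz]
  have hd₁ : (1 : ℝ) ≤ d := by exact_mod_cast hd₀
  have hd₂ : (d : ℝ) ≤ 2 := by exact_mod_cast (show d ≤ 2 by omega)
  have hd₃ : ((3 - d : ℕ) : ℝ) ≤ 2 := by exact_mod_cast (show 3 - d ≤ 2 by omega)
  obtain ⟨g, hg⟩ := exists_schwartzMap_eq_FT d v
  obtain ⟨D, hD, hgD⟩ := g.exists_norm_le_mul_rpow_neg 8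
  let φ : SpX d × SpZ d → ℝ := fun k =>
    (‖k.1‖ ^ q * (1 + ‖k.1‖) ^ (-4 : ℝ)) * (‖k.2‖ ^ (-q) * (1 + ‖k.2‖) ^ (-4 : ℝ))
  have hφ : Integrable φ := by
    refine Integrable.mul_prod (integrable_norm_rpow_mul_one_add_norm_rpow_neg volume hq.1.le ?_)
      (integrable_norm_rpow_neg_mul_one_add_norm_rpow_neg volume hq.1.le ?_ ?_) <;>
    rw [finrank_euclideanSpace_fin] <;> linarith
  have hφ₀ : 0 ≤ ∫ k, φ k := integral_nonneg fun k => by positivity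
  have hne : ∀ᵐ k : SpX d × SpZ d, k.2 ≠ 0 :=
    Measure.quasiMeasurePreserving_snd.ae (Measure.ae_ne volume (0 : SpZ d))
  refine ⟨((2 * Real.pi) ^ 3)⁻¹ * (4 * D * ∫ k, φ k) + 1, by positivity, fun γ hγ _ x => ?_⟩
  have hbound : ‖∫ k : SpX d × SpZ d,
      Complex.exp (Complex.I * ((⟪k.1, x.1⟫ + ⟪k.2, x.2⟫ : ℝ) : ℂ)) *
        (((mdip d nx nz γ k - mdip d nx nz 0 k : ℝ) : ℂ) * FT d v k)‖
      ≤ ∫ k, 4 * γ ^ q * D * φ k := by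
    refine norm_integral_le_of_norm_le (hφ.const_mul _) ?_
    filter_upwards [hne] with k hk
    rw [norm_mul, mul_comm Complex.I, Complex.norm_exp_ofReal_mul_I, one_mul, norm_mul,
      Complex.norm_real, Real.norm_eq_abs, hg]
    have hdecay : ‖g k‖ ≤ D * ((1 + ‖k.1‖) ^ (-4 : ℝ) * (1 + ‖k.2‖) ^ (-4 : ℝ)) := by
      refine (hgD k).trans (mul_le_mul_of_nonneg_left ?_ hD)
      rw [show (-(8 : ℕ) : ℝ) = -(2 * 4) by norm_num]
      exact one_add_norm_prod_rpow_neg_le (by norm_num) k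
    refine (mul_le_mul (abs_mdip_sub_mdip_zero_le d hnx hnz hq.1.le hq.2.le hγ.le k hk) hdecay
      (norm_nonneg _) (by positivity)).trans_eq ?_
    ring
  rw [integral_const_mul] at hbound
  rw [invFT, norm_mul, norm_inv, Complex.norm_real, Real.norm_of_nonneg (by positivity)]
  calc _ ≤ ((2 * Real.pi) ^ 3)⁻¹ * (4 * γ ^ q * D * ∫ k, φ k) := by gcongr
    _ = ((2 * Real.pi) ^ 3)⁻¹ * (4 * D * ∫ k, φ k) * γ ^ q := by ring
    _ ≤ _ := by
      gcongr
      linarith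
end
end

section
/- Let N ≥ 1 and s ≥ 2 be integers, and let S₀ : ℝ^N → ℝ be of class C^{s+1} with all derivatives of order j bounded on ℝ^N for every 2 ≤ j ≤ s+1. Then there exists T > 0 and a function S : [0,T] × ℝ^N → ℝ of class C^s on [0,T] × ℝ^N such that: (i) S(0,x) = S₀(x) for all x; (ii) ∂_t S(t,x) + (1/2)|∇_x S(t,x)|² + (1/2)|x|² = 0 for all (t,x) ∈ [0,T] × ℝ^N; (iii) for each 2 ≤ j ≤ s, the spatial derivatives of S of order j are bounded uniformly on [0,T] × ℝ^N. Moreover S is unique: any two functions with properties (i)-(iii) on a common time interval [0,T'] coincide there. -/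
open Set

noncomputable section

/-- `ℝ^N` as a Euclidean space. -/
abbrev Esp (N : ℕ) : Type := EuclideanSpace ℝ (Fin N)

/-- `S : [0,T] × ℝ^N → ℝ` is a solution of the eikonal equation
`∂_t S + |∇_x S|²/2 + |x|²/2 = 0`, `S(0,·) = S₀`, of class `C^s` on
`[0,T] × ℝ^N` whose spatial derivatives of each order `2 ≤ j ≤ s` are bounded
uniformly on `[0,T] × ℝ^N`. -/
def IsEikonalSolution (N s : ℕ) (S₀ : Esp N → ℝ) (T : ℝ)
    (S : ℝ → Esp N → ℝ) : Prop :=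
  ContDiffOn ℝ s (fun p : ℝ × Esp N => S p.1 p.2) (Icc 0 T ×ˢ univ) ∧
  (∀ x : Esp N, S 0 x = S₀ x) ∧
  (∀ t ∈ Icc 0 T, ∀ x : Esp N,
    HasDerivWithinAt (fun τ : ℝ => S τ x)
      (-(‖gradient (S t) x‖ ^ 2 / 2 + ‖x‖ ^ 2 / 2)) (Icc 0 T) t) ∧
  (∀ j : ℕ, 2 ≤ j → j ≤ s → ∃ C : ℝ,
    ∀ t ∈ Icc 0 T, ∀ x : Esp N, ‖iteratedFDeriv ℝ j (S t) x‖ ≤ C)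

section UniformBounds

variable {ι E F G H : Type*}
  [NormedAddCommGroup E] [NormedSpace ℝ E] [NormedAddCommGroup F] [NormedSpace ℝ F]
  [NormedAddCommGroup G] [NormedSpace ℝ G] [NormedAddCommGroup H] [NormedSpace ℝ H]

/-- A family of `C^n` maps whose derivatives of orders `0,…,n` are bounded uniformly over the
family and over space. -/
structure UnifContDiff (n : ℕ) (f : ι → E → F) : Prop where
  contDiff : ∀ t, ContDiff ℝ n (f t)
  bound : ∃ C : ℝ, 1 ≤ C ∧ ∀ i ≤ n, ∀ t x, ‖iteratedFDeriv ℝ i (f t) x‖ ≤ C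

theorem UnifContDiff.of_bounds {n : ℕ} {f : ι → E → F} (hf : ∀ t, ContDiff ℝ n (f t))
    (h : ∀ i ≤ n, ∃ C : ℝ, ∀ t x, ‖iteratedFDeriv ℝ i (f t) x‖ ≤ C) : UnifContDiff n f := by
  refine ⟨hf, ?_⟩
  choose! C hC using h
  refine ⟨1 + ∑ i ∈ Finset.range (n + 1), |C i|, ?_, fun i hi t x => ?_⟩
  · linarith [Finset.sum_nonneg (s := Finset.range (n + 1)) fun i _ => abs_nonneg (C i)]
  · have := Finset.single_le_sum (s := Finset.range (n + 1)) (fun i _ => abs_nonneg (C i))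
      (Finset.mem_range.2 (Nat.lt_succ_of_le hi))
    linarith [hC i hi t x, le_abs_self (C i)]

theorem UnifContDiff.mono {m n : ℕ} {f : ι → E → F} (hf : UnifContDiff n f) (hmn : m ≤ n) :
    UnifContDiff m f := by
  obtain ⟨C, hC1, hC⟩ := hf.bound
  exact ⟨fun t => (hf.contDiff t).of_le (by exact_mod_cast hmn),
    C, hC1, fun i hi => hC i (hi.trans hmn)⟩

theorem unifContDiff_const (n : ℕ) (c : F) : UnifContDiff n (fun (_ : ι) (_ : E) => c) := by
  refine .of_bounds (fun _ => contDiff_const) fun i _ => ⟨‖c‖, fun t x => ?_⟩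
  rcases i with _ | i
  · simp
  · simp [iteratedFDeriv_const_of_ne (𝕜 := ℝ) (Nat.succ_ne_zero i) c]

theorem UnifContDiff.add {n : ℕ} {f g : ι → E → F} (hf : UnifContDiff n f)
    (hg : UnifContDiff n g) : UnifContDiff n (fun t x => f t x + g t x) := by
  obtain ⟨C, -, hC⟩ := hf.bound
  obtain ⟨D, -, hD⟩ := hg.bound
  refine .of_bounds (fun t => (hf.contDiff t).add (hg.contDiff t)) fun i hi =>
    ⟨C + D, fun t x => ?_⟩
  have hin : (i : WithTop ℕ∞) ≤ n := by exact_mod_cast hi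
  have := iteratedFDeriv_add_apply (i := i) ((hf.contDiff t).of_le hin).contDiffAt
    ((hg.contDiff t).of_le hin).contDiffAt (x := x)
  change ‖iteratedFDeriv ℝ i (f t + g t) x‖ ≤ _
  rw [this]
  exact (norm_add_le _ _).trans (add_le_add (hC i hi t x) (hD i hi t x))

theorem UnifContDiff.smul {n : ℕ} {f : ι → E → F} (hf : UnifContDiff n f) {c : ι → ℝ} {K : ℝ}
    (hc : ∀ t, |c t| ≤ K) : UnifContDiff n (fun t x => c t • f t x) := by
  obtain ⟨C, hC1, hC⟩ := hf.bound
  refine .of_bounds (fun t => (hf.contDiff t).const_smul _) fun i hi =>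
    ⟨K * C, fun t x => ?_⟩
  have hin : (i : WithTop ℕ∞) ≤ n := by exact_mod_cast hi
  change ‖iteratedFDeriv ℝ i (c t • f t) x‖ ≤ _
  rw [iteratedFDeriv_const_smul_apply ((hf.contDiff t).of_le hin).contDiffAt, norm_smul]
  exact mul_le_mul (hc t) (hC i hi t x) (norm_nonneg _) ((abs_nonneg _).trans (hc t))

/-- The Leibniz bound for a composition of operator-valued maps. -/
theorem norm_iteratedFDeriv_clm_comp_le {n : ℕ} {f : E → G →L[ℝ] H} {g : E → F →L[ℝ] G}
    (hf : ContDiff ℝ n f) (hg : ContDiff ℝ n g) (x : E) {i : ℕ} (hi : i ≤ n) :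
    ‖iteratedFDeriv ℝ i (fun y => (f y).comp (g y)) x‖ ≤
      ∑ k ∈ Finset.range (i + 1),
        (i.choose k : ℝ) * ‖iteratedFDeriv ℝ k f x‖ * ‖iteratedFDeriv ℝ (i - k) g x‖ :=
  (ContinuousLinearMap.compL ℝ F G H).norm_iteratedFDeriv_le_of_bilinear_of_le_one hf hg x
    (by exact_mod_cast hi) (ContinuousLinearMap.norm_compL_le ℝ F G H)

theorem UnifContDiff.clm_comp {n : ℕ} {f : ι → E → G →L[ℝ] H} {g : ι → E → F →L[ℝ] G}
    (hf : UnifContDiff n f) (hg : UnifContDiff n g) :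
    UnifContDiff n (fun t x => (f t x).comp (g t x)) := by
  obtain ⟨C, hC1, hC⟩ := hf.bound
  obtain ⟨D, hD1, hD⟩ := hg.bound
  refine .of_bounds (fun t => (hf.contDiff t).clm_comp (hg.contDiff t)) fun i hi =>
    ⟨∑ k ∈ Finset.range (i + 1), (i.choose k : ℝ) * C * D, fun t x => ?_⟩
  refine (norm_iteratedFDeriv_clm_comp_le (hf.contDiff t) (hg.contDiff t) x hi).trans ?_
  refine Finset.sum_le_sum fun k hk => ?_
  have hk' : k ≤ i := Nat.lt_succ_iff.1 (Finset.mem_range.1 hk)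
  gcongr
  · exact hC k (hk'.trans hi) t x
  · exact hD _ ((Nat.sub_le _ _).trans hi) t x

/-- Composition with inner maps whose derivative is uniformly bounded in `C^m`. -/
theorem UnifContDiff.comp {m n : ℕ} {g : ι → F → G} {f : ι → E → F} (hg : UnifContDiff n g)
    (hf : ∀ t, ContDiff ℝ n (f t)) (hf' : UnifContDiff m fun t => fderiv ℝ (f t))
    (hnm : n ≤ m + 1) : UnifContDiff n (fun t x => g t (f t x)) := by
  obtain ⟨C, hC1, hC⟩ := hg.bound
  obtain ⟨D, hD1, hD⟩ := hf'.bound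
  refine .of_bounds (fun t => (hg.contDiff t).comp (hf t)) fun i hi =>
    ⟨i.factorial * C * D ^ i, fun t x => ?_⟩
  refine norm_iteratedFDeriv_comp_le (hg.contDiff t) (hf t) (by exact_mod_cast hi) x
    (fun k hk => hC k (hk.trans hi) t _) fun k hk1 hk => ?_
  obtain ⟨k, rfl⟩ : ∃ l, k = l + 1 := ⟨k - 1, by omega⟩
  rw [← norm_iteratedFDeriv_fderiv]
  exact (hD k (by omega) t x).trans (le_self_pow₀ hD1 (by omega))

/-- If the derivative of `Y t` satisfies `DY = id - B(Y) ∘ DY` with `‖B‖ ≤ 1/2` and `B` uniformly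
bounded in `C^n`, then `DY` is uniformly bounded in `C^n`. -/
theorem unifContDiff_fderiv_of_resolvent {n : ℕ} {B : ι → E → E →L[ℝ] E} {Y : ι → E → E}
    (hB : UnifContDiff n B) (hB2 : ∀ t x, ‖B t x‖ ≤ 1 / 2)
    (hY : ∀ t, ContDiff ℝ (n + 1 : ℕ) (Y t))
    (hDY : ∀ t x, fderiv ℝ (Y t) x =
      ContinuousLinearMap.id ℝ E - (B t (Y t x)).comp (fderiv ℝ (Y t) x)) :
    UnifContDiff n fun t => fderiv ℝ (Y t) := by
  have hZ : ∀ t, ContDiff ℝ n (fderiv ℝ (Y t)) := fun t =>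
    (hY t).fderiv_right (by norm_cast)
  suffices ∀ m ≤ n, UnifContDiff m fun t => fderiv ℝ (Y t) from this n le_rfl
  intro m
  induction m with
  | zero =>
    intro _
    refine .of_bounds (fun t => (hZ t).of_le (by simp)) fun i hi => ⟨2, fun t x => ?_⟩
    obtain rfl : i = 0 := by omega
    rw [norm_iteratedFDeriv_zero]
    have h1 : ‖fderiv ℝ (Y t) x‖ ≤ 1 + 1 / 2 * ‖fderiv ℝ (Y t) x‖ := by
      conv_lhs => rw [hDY]
      refine (norm_sub_le _ _).trans (add_le_add ContinuousLinearMap.norm_id_le ?_)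
      refine (ContinuousLinearMap.opNorm_comp_le _ _).trans ?_
      gcongr
      exact hB2 _ _
    linarith
  | succ m ih =>
    intro hm
    have hm' := ih (by omega)
    obtain ⟨D, hD1, hD⟩ := hm'.bound
    have hBY : UnifContDiff (m + 1) fun t x => B t (Y t x) :=
      (hB.mono hm).comp (fun t => (hY t).of_le (by norm_cast; omega)) hm' le_rfl
    obtain ⟨C, hC1, hC⟩ := hBY.bound
    refine .of_bounds (fun t => (hZ t).of_le (by exact_mod_cast hm)) fun i hi => ?_
    rcases Nat.lt_or_ge i (m + 1) with hlt | hge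
    · exact ⟨D, fun t x => hD i (by omega) t x⟩
    obtain rfl : i = m + 1 := by omega
    refine ⟨2 * ∑ k ∈ Finset.range (m + 1), ((m + 1).choose (k + 1) : ℝ) * C * D,
      fun t x => ?_⟩
    have hZm : ContDiff ℝ (m + 1 : ℕ) (fderiv ℝ (Y t)) := (hZ t).of_le (by exact_mod_cast hm)
    have hcomp := norm_iteratedFDeriv_clm_comp_le (hBY.contDiff t) hZm x (le_refl (m + 1))
    rw [Finset.sum_range_succ'] at hcomp
    have hrest : ∑ k ∈ Finset.range (m + 1), ((m + 1).choose (k + 1) : ℝ) *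
        ‖iteratedFDeriv ℝ (k + 1) (fun x => B t (Y t x)) x‖ *
        ‖iteratedFDeriv ℝ (m + 1 - (k + 1)) (fderiv ℝ (Y t)) x‖ ≤
        ∑ k ∈ Finset.range (m + 1), ((m + 1).choose (k + 1) : ℝ) * C * D := by
      refine Finset.sum_le_sum fun k hk => ?_
      have := Finset.mem_range.1 hk
      gcongr
      · exact hC _ (by omega) t x
      · exact hD _ (by omega) t x
    have heq : ‖iteratedFDeriv ℝ (m + 1) (fderiv ℝ (Y t)) x‖ =
        ‖iteratedFDeriv ℝ (m + 1) (fun x => (B t (Y t x)).comp (fderiv ℝ (Y t) x)) x‖ := by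
      have hfun : fderiv ℝ (Y t) = (fun _ => ContinuousLinearMap.id ℝ E) +
          (-1 : ℝ) • (fun x => (B t (Y t x)).comp (fderiv ℝ (Y t) x)) := by
        funext x
        conv_lhs => rw [hDY]
        simp [sub_eq_add_neg]
      have hcd := ((hBY.contDiff t).clm_comp hZm)
      have hcd' : ContDiff ℝ (m + 1 : ℕ)
          ((-1 : ℝ) • fun x => (B t (Y t x)).comp (fderiv ℝ (Y t) x)) :=
        contDiff_const.smul hcd
      conv_lhs => rw [hfun]
      rw [iteratedFDeriv_add_apply contDiff_const.contDiffAt hcd'.contDiffAt,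
        iteratedFDeriv_const_smul_apply hcd.contDiffAt,
        iteratedFDeriv_const_of_ne (𝕜 := ℝ) (Nat.succ_ne_zero m)]
      simp
    have h0 : ‖iteratedFDeriv ℝ 0 (fun x => B t (Y t x)) x‖ ≤ 1 / 2 := by
      rw [norm_iteratedFDeriv_zero]; exact hB2 _ _
    have h1 := mul_le_mul_of_nonneg_right h0
      (norm_nonneg (iteratedFDeriv ℝ (m + 1) (fderiv ℝ (Y t)) x))
    rw [← heq] at hcomp
    simp only [Nat.choose_zero_right, Nat.cast_one, one_mul, Nat.sub_zero] at hcomp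
    linarith

end UniformBounds

section Uniqueness

variable {N s : ℕ} {S₀ : Esp N → ℝ} {T : ℝ} {S S₁ S₂ : ℝ → Esp N → ℝ}

theorem IsEikonalSolution.contDiff_slice (h : IsEikonalSolution N s S₀ T S) {t : ℝ}
    (ht : t ∈ Icc 0 T) : ContDiff ℝ s (S t) := by
  have : ContDiffOn ℝ s (fun x => S t x) univ :=
    h.1.comp (g := fun p : ℝ × Esp N => S p.1 p.2) (f := fun x => (t, x))
      (contDiff_const.prodMk contDiff_id).contDiffOn fun x _ => ⟨ht, mem_univ _⟩
  exact contDiffOn_univ.1 this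

theorem IsEikonalSolution.norm_gradient_le (h : IsEikonalSolution N s S₀ T S) (hs : 2 ≤ s)
    (hT : 0 < T) : ∃ C : ℝ, 0 ≤ C ∧
      ∀ t ∈ Icc 0 T, ∀ x, ‖gradient (S t) x‖ ≤ C * (1 + ‖x‖) := by
  obtain ⟨C, hC⟩ := h.2.2.2 2 le_rfl hs
  have hud : UniqueDiffOn ℝ (Icc 0 T ×ˢ (univ : Set (Esp N))) :=
    (uniqueDiffOn_Icc hT).prod uniqueDiffOn_univ
  have hs1 : (1 : WithTop ℕ∞) ≤ s := by exact_mod_cast (by omega : 1 ≤ s)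
  have hcont := h.1.continuousOn_fderivWithin hud hs1
  have hcont0 : ContinuousOn (fun t : ℝ => fderivWithin ℝ (fun p : ℝ × Esp N => S p.1 p.2)
      (Icc 0 T ×ˢ univ) (t, 0)) (Icc 0 T) :=
    hcont.comp (f := fun t : ℝ => (t, (0 : Esp N))) (by fun_prop)
      fun t ht => ⟨ht, mem_univ _⟩
  obtain ⟨D, hD⟩ := isCompact_Icc.exists_bound_of_continuousOn hcont0
  have hfd0 : ∀ t ∈ Icc 0 T, ‖fderiv ℝ (S t) 0‖ ≤ D := by
    intro t ht
    have h1 := ((h.1.differentiableOn (by positivity)) (t, 0) ⟨ht, mem_univ _⟩).hasFDerivWithinAt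
    have h2 : HasFDerivWithinAt (S t) ((fderivWithin ℝ (fun p : ℝ × Esp N => S p.1 p.2)
        (Icc 0 T ×ˢ univ) (t, 0)).comp (ContinuousLinearMap.inr ℝ ℝ (Esp N))) univ 0 :=
      h1.comp (f := fun x => (t, x)) (0 : Esp N)
        (hasFDerivAt_prodMk_right t (0 : Esp N)).hasFDerivWithinAt
        fun x _ => ⟨ht, mem_univ _⟩
    rw [(hasFDerivWithinAt_univ.1 h2).fderiv]
    refine (ContinuousLinearMap.opNorm_comp_le _ _).trans ?_
    have := ContinuousLinearMap.norm_inr_le_one ℝ ℝ (Esp N)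
    have h3 := hD t ht
    nlinarith [norm_nonneg (fderivWithin ℝ (fun p : ℝ × Esp N => S p.1 p.2)
      (Icc 0 T ×ˢ univ) (t, 0))]
  refine ⟨|C| + |D|, by positivity, fun t ht x => ?_⟩
  have hS := h.contDiff_slice ht
  have hC2 : ∀ y, ‖fderiv ℝ (fderiv ℝ (S t)) y‖ ≤ C := fun y => by
    rw [← norm_iteratedFDeriv_one, norm_iteratedFDeriv_fderiv]
    exact hC t ht y
  have hd : Differentiable ℝ (fderiv ℝ (S t)) :=
    (hS.fderiv_right (m := 1) (by exact_mod_cast hs)).differentiable one_ne_zero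
  have hmv := convex_univ.norm_image_sub_le_of_norm_fderiv_le (f := fderiv ℝ (S t))
    (fun y _ => hd y) (fun y _ => hC2 y) (mem_univ 0) (mem_univ x)
  have hn : ‖gradient (S t) x‖ = ‖fderiv ℝ (S t) x‖ := by
    rw [← toDual_gradient, LinearIsometryEquiv.norm_map]
  have htri := norm_le_norm_sub_add (fderiv ℝ (S t) x) (fderiv ℝ (S t) 0)
  rw [sub_zero] at hmv
  have := hfd0 t ht
  rw [hn]
  nlinarith [le_abs_self C, le_abs_self D, norm_nonneg x, abs_nonneg C, abs_nonneg D]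

/-- Comparison: by the maximum principle applied to `arctan (S₁ - S₂)` with barrier
`δ e^{Kt} (1 + |x|²)`. -/
theorem IsEikonalSolution.le (h₁ : IsEikonalSolution N s S₀ T S₁)
    (h₂ : IsEikonalSolution N s S₀ T S₂) (hs : 2 ≤ s) (hT : 0 < T) {t : ℝ} (ht : t ∈ Icc 0 T)
    (x : Esp N) : S₁ t x ≤ S₂ t x := by
  obtain ⟨C₁, hC₁, hg₁⟩ := h₁.norm_gradient_le hs hT
  obtain ⟨C₂, hC₂, hg₂⟩ := h₂.norm_gradient_le hs hT
  by_contra! hlt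
  set K : ℝ := 4 * (C₁ + C₂) + 1
  let v : ℝ × Esp N → ℝ := fun p => Real.arctan (S₁ p.1 p.2 - S₂ p.1 p.2)
  let g : ℝ × Esp N → ℝ := fun p => Real.exp (K * p.1) * (1 + ‖p.2‖ ^ 2)
  have hv0 : 0 < v (t, x) := by
    have : Real.arctan 0 < Real.arctan (S₁ t x - S₂ t x) :=
      Real.arctan_strictMono (sub_pos.2 hlt)
    simpa [v] using this
  have hgpos : ∀ p, 0 < g p := fun p => by positivity
  obtain ⟨δ, hδ, hδv⟩ : ∃ δ > 0, 0 < v (t, x) - δ * g (t, x) := by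
    refine ⟨v (t, x) / (2 * g (t, x)), by have := hgpos (t, x); positivity, ?_⟩
    have := hgpos (t, x)
    field_simp
    linarith
  set φ : ℝ × Esp N → ℝ := fun p => v p - δ * g p with hφ
  have hKpos : 0 < K := by positivity
  have hcont : ContinuousOn φ (Icc 0 T ×ˢ univ) := by
    have hw : ContinuousOn (fun p : ℝ × Esp N => S₁ p.1 p.2 - S₂ p.1 p.2) (Icc 0 T ×ˢ univ) :=
      h₁.1.continuousOn.sub h₂.1.continuousOn
    exact (Real.continuous_arctan.comp_continuousOn hw).sub
      (by fun_prop : Continuous fun p => δ * g p).continuousOn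
  -- the maximum is attained
  obtain ⟨R, hR⟩ : ∃ R : ℝ, ∀ p ∈ Icc 0 T ×ˢ (univ : Set (Esp N)), R < ‖p.2‖ → φ p ≤ 0 := by
    refine ⟨2 / δ + 1, fun p hp hRp => ?_⟩
    have h1 : v p ≤ 2 := by
      have := Real.arctan_lt_pi_div_two (S₁ p.1 p.2 - S₂ p.1 p.2)
      have := Real.pi_le_four
      simp only [v]; linarith
    have h2 : 1 + ‖p.2‖ ^ 2 ≤ g p :=
      le_mul_of_one_le_left (by positivity)
        (Real.one_le_exp (mul_nonneg hKpos.le hp.1.1))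
    have h3 : 2 / δ ≤ g p := by
      have : 0 < 2 / δ := by positivity
      nlinarith
    have h4 : 2 ≤ δ * g p := by
      rw [div_le_iff₀ hδ] at h3; linarith
    simp only [hφ]; linarith
  obtain ⟨⟨t₁, x₁⟩, hp₁, hmax'⟩ := (isCompact_Icc.prod (isCompact_closedBall (0 : Esp N)
    (max R ‖x‖))).exists_isMaxOn ⟨(t, x), ht, by simp⟩
    (hcont.mono (prod_mono le_rfl (subset_univ _)))
  have htx : φ (t, x) ≤ φ (t₁, x₁) := hmax' ⟨ht, by simp⟩
  have hφpos : 0 < φ (t₁, x₁) := hδv.trans_le htx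
  have ht₁ : t₁ ∈ Icc 0 T := hp₁.1
  have hmax : ∀ p ∈ Icc 0 T ×ˢ (univ : Set (Esp N)), φ p ≤ φ (t₁, x₁) := by
    intro p hp
    by_cases hpR : ‖p.2‖ ≤ max R ‖x‖
    · exact hmax' ⟨hp.1, by simpa using hpR⟩
    · exact (hR p hp ((le_max_left _ _).trans_lt (not_le.1 hpR))).trans hφpos.le
  have ht₁pos : 0 < t₁ := by
    refine ht₁.1.lt_of_ne fun h0 => ?_
    have : v (t₁, x₁) = 0 := by
      simp only [v, ← h0, h₁.2.1, h₂.2.1, sub_self, Real.arctan_zero]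
    have h3 := mul_pos hδ (hgpos (t₁, x₁))
    simp only [hφ] at hφpos
    linarith
  -- first-order conditions
  set w := S₁ t₁ x₁ - S₂ t₁ x₁
  set a := gradient (S₁ t₁) x₁
  set b := gradient (S₂ t₁) x₁
  have hs0 : (s : WithTop ℕ∞) ≠ 0 := by positivity
  have hgrad : ∀ y : Esp N, 1 / (1 + w ^ 2) * inner ℝ (a - b) y =
      δ * (Real.exp (K * t₁) * (2 * inner ℝ x₁ y)) := by
    intro y
    have hf₁ : HasFDerivAt (S₁ t₁) (InnerProductSpace.toDual ℝ (Esp N) a) x₁ :=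
      ((h₁.contDiff_slice ht₁).differentiable hs0 x₁).hasGradientAt
    have hf₂ : HasFDerivAt (S₂ t₁) (InnerProductSpace.toDual ℝ (Esp N) b) x₁ :=
      ((h₂.contDiff_slice ht₁).differentiable hs0 x₁).hasGradientAt
    have hgx := ((((hasFDerivAt_id x₁).norm_sq).const_add 1).const_mul
      (Real.exp (K * t₁))).const_mul δ
    have hd := ((hf₁.sub hf₂).arctan).sub hgx
    have hloc : IsLocalMax (fun y => φ (t₁, y)) x₁ :=
      Filter.Eventually.of_forall fun y => hmax (t₁, y) ⟨ht₁, mem_univ _⟩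
    have h0 := DFunLike.congr_fun (hloc.hasFDerivAt_eq_zero hd) y
    simp [inner_sub_left, InnerProductSpace.toDual_apply_apply] at h0 ⊢
    linarith
  have htime : δ * (Real.exp (K * t₁) * K * (1 + ‖x₁‖ ^ 2)) ≤
      1 / (1 + w ^ 2) * (-(‖a‖ ^ 2 / 2 + ‖x₁‖ ^ 2 / 2) - -(‖b‖ ^ 2 / 2 + ‖x₁‖ ^ 2 / 2)) := by
    have hd₁ := h₁.2.2.1 t₁ ht₁ x₁
    have hd₂ := h₂.2.2.1 t₁ ht₁ x₁
    have he : HasDerivWithinAt (fun τ : ℝ => δ * (Real.exp (K * τ) * (1 + ‖x₁‖ ^ 2)))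
        (δ * (Real.exp (K * t₁) * K * (1 + ‖x₁‖ ^ 2))) (Icc 0 T) t₁ := by
      have := ((((hasDerivAt_id t₁).const_mul K).exp.mul_const (1 + ‖x₁‖ ^ 2)).const_mul δ)
      simpa using this.hasDerivWithinAt
    have hd := ((hd₁.sub hd₂).arctan).sub he
    have hloc : IsLocalMaxOn (fun τ => φ (τ, x₁)) (Icc 0 T) t₁ :=
      IsMaxOn.localize fun τ hτ => hmax (τ, x₁) ⟨hτ, mem_univ _⟩
    have hcone : (0 : ℝ) - t₁ ∈ posTangentConeAt (Icc 0 T) t₁ :=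
      sub_mem_posTangentConeAt_of_segment_subset
        ((convex_Icc 0 T).segment_subset ht₁ ⟨le_rfl, hT.le⟩)
    have h0 := hloc.hasFDerivWithinAt_nonpos hd.hasFDerivWithinAt hcone
    simp only [ContinuousLinearMap.toSpanSingleton_apply, smul_eq_mul] at h0
    have := nonneg_of_mul_nonpos_right h0 (by linarith)
    simp only [Pi.sub_apply] at this
    linarith
  have hab : -(‖a‖ ^ 2 / 2 + ‖x₁‖ ^ 2 / 2) - -(‖b‖ ^ 2 / 2 + ‖x₁‖ ^ 2 / 2) =
      -(1 / 2) * inner ℝ (a - b) (a + b) := by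
    simp only [inner_sub_left, inner_add_right, real_inner_self_eq_norm_sq, real_inner_comm]
    ring
  have hin : -inner ℝ x₁ (a + b) ≤ ‖x₁‖ * ((C₁ + C₂) * (1 + ‖x₁‖)) := by
    have h1 := neg_le_of_abs_le (abs_real_inner_le_norm x₁ (a + b))
    have h2 := norm_add_le a b
    have h3 := hg₁ t₁ ht₁ x₁
    have h4 := hg₂ t₁ ht₁ x₁
    have h5 : ‖a + b‖ ≤ (C₁ + C₂) * (1 + ‖x₁‖) := by
      calc _ ≤ _ := h2
        _ ≤ _ := add_le_add h3 h4
        _ = _ := by ring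
    have := mul_le_mul_of_nonneg_left h5 (norm_nonneg x₁)
    linarith
  have hfin : δ * (Real.exp (K * t₁) * K * (1 + ‖x₁‖ ^ 2)) ≤
      δ * (Real.exp (K * t₁) * -inner ℝ x₁ (a + b)) := by
    refine htime.trans (le_of_eq ?_)
    rw [hab]
    linear_combination -(1 / 2) * hgrad (a + b)
  have h6 : K * (1 + ‖x₁‖ ^ 2) ≤ -inner ℝ x₁ (a + b) := by
    have hpos : 0 < δ * Real.exp (K * t₁) := by positivity
    refine le_of_mul_le_mul_left ?_ hpos
    linarith
  have h7 : ‖x₁‖ * ((C₁ + C₂) * (1 + ‖x₁‖)) ≤ 4 * (C₁ + C₂) * (1 + ‖x₁‖ ^ 2) := by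
    nlinarith [mul_nonneg (add_nonneg hC₁ hC₂) (sq_nonneg (‖x₁‖ - 1)),
      mul_nonneg (add_nonneg hC₁ hC₂) (sq_nonneg ‖x₁‖), add_nonneg hC₁ hC₂]
  nlinarith [sq_nonneg ‖x₁‖]

end Uniqueness

section Rays

open Function Filter Topology
open scoped RealInnerProductSpace

theorem bijective_of_lipschitzWith_sub_id {E : Type*} [NormedAddCommGroup E] [CompleteSpace E]
    {f : E → E}
    (hf : LipschitzWith (1 / 2) fun y => f y - y) : Bijective f := by
  have hx : ∀ x, ContractingWith (1 / 2) fun y => x - (f y - y) := fun x =>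
    ⟨by norm_num, by
      simpa only [zero_add] using (LipschitzWith.const x).sub hf⟩
  have key : ∀ {x y}, f y = x ↔ IsFixedPt (fun y => x - (f y - y)) y := fun {x y} => by
    rw [IsFixedPt, sub_sub_eq_add_sub, add_comm, add_sub_assoc, add_eq_left, sub_eq_zero, eq_comm]
  exact ⟨fun y z h => ContractingWith.fixedPoint_unique' (hx (f z)) (key.1 h) (key.1 rfl),
    fun x => ⟨_, key.2 (hx x).fixedPoint_isFixedPt⟩⟩

variable {E : Type*} [NormedAddCommGroup E] [InnerProductSpace ℝ E]

/-- Position at time `t` of the ray (of the harmonic oscillator) starting at `y` with momentum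
`p y`. -/
def rayPos (p : E → E) (t : ℝ) (y : E) : E := Real.cos t • y + Real.sin t • p y

/-- Momentum at time `t` of the ray starting at `y` with momentum `p y`. -/
def rayMom (p : E → E) (t : ℝ) (y : E) : E := (-Real.sin t) • y + Real.cos t • p y

/-- The action transported along the rays. -/
def rayAction (S₀ : E → ℝ) (p : E → E) (t : ℝ) (y : E) : ℝ :=
  S₀ y + (⟪rayPos p t y, rayMom p t y⟫ - ⟪y, p y⟫) / 2

/-- The spatial derivative of `rayPos p t`, minus the identity. -/
def rayDefect (p : E → E) (t : ℝ) (y : E) : E →L[ℝ] E :=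
  (Real.cos t - 1) • ContinuousLinearMap.id ℝ E + Real.sin t • fderiv ℝ p y

/-- The initial point of the ray through `x` at time `t`. -/
def rayFoot (p : E → E) (t : ℝ) (x : E) : E := invFun (rayPos p t) x

variable {p : E → E} {S₀ : E → ℝ} {t : ℝ} {x y : E} {n : WithTop ℕ∞}

theorem contDiff_rayPos (hp : ContDiff ℝ n p) :
    ContDiff ℝ n fun q : ℝ × E => rayPos p q.1 q.2 :=
  ((Real.contDiff_cos.comp contDiff_fst).smul contDiff_snd).add
    ((Real.contDiff_sin.comp contDiff_fst).smul (hp.comp contDiff_snd))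

theorem contDiff_rayMom (hp : ContDiff ℝ n p) :
    ContDiff ℝ n fun q : ℝ × E => rayMom p q.1 q.2 :=
  ((Real.contDiff_sin.comp contDiff_fst).neg.smul contDiff_snd).add
    ((Real.contDiff_cos.comp contDiff_fst).smul (hp.comp contDiff_snd))

theorem contDiff_rayAction (hS₀ : ContDiff ℝ n S₀) (hp : ContDiff ℝ n p) :
    ContDiff ℝ n fun q : ℝ × E => rayAction S₀ p q.1 q.2 :=
  (hS₀.comp contDiff_snd).add
    ((((contDiff_rayPos hp).inner ℝ (contDiff_rayMom hp)).sub
      (contDiff_snd.inner ℝ (hp.comp contDiff_snd))).div_const 2)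

theorem hasFDerivAt_rayPos (hp : DifferentiableAt ℝ p y) :
    HasFDerivAt (fun q : ℝ × E => rayPos p q.1 q.2)
      ((ContinuousLinearMap.fst ℝ ℝ E).smulRight (rayMom p t y) +
        (ContinuousLinearMap.id ℝ E + rayDefect p t y).comp (ContinuousLinearMap.snd ℝ ℝ E))
      (t, y) := by
  have hfst : HasFDerivAt (fun q : ℝ × E => q.1) (ContinuousLinearMap.fst ℝ ℝ E) (t, y) :=
    hasFDerivAt_fst
  have hsnd : HasFDerivAt (fun q : ℝ × E => q.2) (ContinuousLinearMap.snd ℝ ℝ E) (t, y) :=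
    hasFDerivAt_snd
  have hpy : HasFDerivAt (fun q : ℝ × E => p q.2) _ (t, y) :=
    HasFDerivAt.comp (g := p) (t, y) hp.hasFDerivAt hsnd
  have h := (hfst.cos.smul hsnd).add (hfst.sin.smul hpy)
  refine h.congr_fderiv ?_
  ext <;> simp [rayMom, rayDefect, sub_smul]
  abel

theorem hasFDerivAt_rayMom (hp : DifferentiableAt ℝ p y) :
    HasFDerivAt (fun q : ℝ × E => rayMom p q.1 q.2)
      ((ContinuousLinearMap.fst ℝ ℝ E).smulRight (-rayPos p t y) +
        ((-Real.sin t) • ContinuousLinearMap.id ℝ E + Real.cos t • fderiv ℝ p y).comp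
          (ContinuousLinearMap.snd ℝ ℝ E))
      (t, y) := by
  have hfst : HasFDerivAt (fun q : ℝ × E => q.1) (ContinuousLinearMap.fst ℝ ℝ E) (t, y) :=
    hasFDerivAt_fst
  have hsnd : HasFDerivAt (fun q : ℝ × E => q.2) (ContinuousLinearMap.snd ℝ ℝ E) (t, y) :=
    hasFDerivAt_snd
  have hpy : HasFDerivAt (fun q : ℝ × E => p q.2) _ (t, y) :=
    HasFDerivAt.comp (g := p) (t, y) hp.hasFDerivAt hsnd
  have h := (hfst.sin.neg.smul hsnd).add (hfst.cos.smul hpy)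
  refine h.congr_fderiv ?_
  ext <;> simp [rayPos]
  abel

theorem hasFDerivAt_rayAction [CompleteSpace E] (hS₀ : HasGradientAt S₀ (p y) y)
    (hp : DifferentiableAt ℝ p y) :
    HasFDerivAt (fun q : ℝ × E => rayAction S₀ p q.1 q.2)
      (((‖rayMom p t y‖ ^ 2 - ‖rayPos p t y‖ ^ 2) / 2) • ContinuousLinearMap.fst ℝ ℝ E +
        (innerSL ℝ (rayMom p t y)).comp
          ((ContinuousLinearMap.id ℝ E + rayDefect p t y).comp (ContinuousLinearMap.snd ℝ ℝ E)))
      (t, y) := by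
  have hsnd : HasFDerivAt (fun q : ℝ × E => q.2) (ContinuousLinearMap.snd ℝ ℝ E) (t, y) :=
    hasFDerivAt_snd
  have hpy : HasFDerivAt (fun q : ℝ × E => p q.2) _ (t, y) :=
    HasFDerivAt.comp (g := p) (t, y) hp.hasFDerivAt hsnd
  have hSy : HasFDerivAt (fun q : ℝ × E => S₀ q.2) _ (t, y) :=
    HasFDerivAt.comp (g := S₀) (t, y) hS₀.hasFDerivAt hsnd
  have h := hSy.add ((((hasFDerivAt_rayPos (t := t) hp).inner ℝ (hasFDerivAt_rayMom hp)).sub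
    (hsnd.inner ℝ hpy)).mul_const (2⁻¹ : ℝ))
  have h' : HasFDerivAt (fun q : ℝ × E => rayAction S₀ p q.1 q.2) _ (t, y) := h
  refine h'.congr_fderiv ?_
  have hcs := Real.sin_sq_add_cos_sq t
  ext v
  · simp
    ring
  · simp [rayDefect, rayPos, rayMom, inner_add_left, inner_add_right, inner_smul_left,
      inner_smul_right, InnerProductSpace.toDual_apply_apply, real_inner_comm]
    linear_combination (1 / 2 * ⟪y, fderiv ℝ p y v⟫ - 1 / 2 * ⟪v, p y⟫) * hcs

theorem hasFDerivAt_rayPos_sub_id (hp : DifferentiableAt ℝ p y) :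
    HasFDerivAt (fun y => rayPos p t y - y) (rayDefect p t y) y := by
  have h := (((hasFDerivAt_id y).const_smul (Real.cos t)).add
    (hp.hasFDerivAt.const_smul (Real.sin t))).sub (hasFDerivAt_id y)
  refine h.congr_fderiv ?_
  ext v
  simp [rayDefect, sub_smul]
  abel

theorem rayPos_bijective [CompleteSpace E] (hp : Differentiable ℝ p)
    (h : ∀ y, ‖rayDefect p t y‖ ≤ 1 / 2) : Bijective (rayPos p t) := by
  refine bijective_of_lipschitzWith_sub_id (lipschitzWith_of_nnnorm_fderiv_le
    (fun y => (hasFDerivAt_rayPos_sub_id (hp y)).differentiableAt) fun y => ?_)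
  rw [(hasFDerivAt_rayPos_sub_id (hp y)).fderiv]
  exact_mod_cast h y

theorem rayPos_rayFoot (h : Bijective (rayPos p t)) (x : E) : rayPos p t (rayFoot p t x) = x :=
  rightInverse_invFun h.2 x

theorem contDiffAt_rayFoot [FiniteDimensional ℝ E] (hp : ContDiff ℝ n p) (hn : n ≠ 0)
    (hbij : ∀ᶠ τ in 𝓝 t, Bijective (rayPos p τ)) (hd : ∀ y, ‖rayDefect p t y‖ ≤ 1 / 2) (x : E) :
    ContDiffAt ℝ n (fun q : ℝ × E => rayFoot p q.1 q.2) (t, x) := by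
  have : CompleteSpace E := FiniteDimensional.complete ℝ E
  obtain ⟨y, rfl⟩ := hbij.self_of_nhds.2 x
  let Φ : ℝ × E → ℝ × E := fun q => (q.1, rayPos p q.1 q.2)
  have hΦ : ContDiff ℝ n Φ := contDiff_fst.prodMk (contDiff_rayPos hp)
  have hΦ' := (hasFDerivAt_fst (𝕜 := ℝ) (p := (t, y))).prodMk
    (hasFDerivAt_rayPos (t := t) (hp.differentiable hn y))
  set L := (ContinuousLinearMap.fst ℝ ℝ E).prod
    ((ContinuousLinearMap.fst ℝ ℝ E).smulRight (rayMom p t y) +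
      (ContinuousLinearMap.id ℝ E + rayDefect p t y).comp (ContinuousLinearMap.snd ℝ ℝ E)) with hL
  have hinj : Injective (L : ℝ × E →ₗ[ℝ] ℝ × E) := by
    rw [← LinearMap.ker_eq_bot, LinearMap.ker_eq_bot']
    rintro ⟨τ, η⟩ h
    obtain ⟨h1, h2⟩ : τ = 0 ∧ τ • rayMom p t y + (η + rayDefect p t y η) = 0 := by
      simpa [hL] using h
    subst h1
    have h3 : η = -rayDefect p t y η := by simpa [add_eq_zero_iff_eq_neg] using h2
    have h4 : ‖η‖ ≤ 1 / 2 * ‖η‖ := by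
      conv_lhs => rw [h3, norm_neg]
      exact (rayDefect p t y).le_of_opNorm_le (hd y) η
    have h5 : ‖η‖ = 0 := by linarith [norm_nonneg η]
    simpa using h5
  let e : (ℝ × E) ≃L[ℝ] (ℝ × E) :=
    (LinearEquiv.ofInjectiveEndo (L : ℝ × E →ₗ[ℝ] ℝ × E) hinj).toContinuousLinearEquiv
  have hΦe : HasFDerivAt Φ (e : ℝ × E →L[ℝ] ℝ × E) (t, y) :=
    hΦ'.congr_fderiv (ContinuousLinearMap.ext fun v => rfl)
  refine (hΦ.contDiffAt.to_localInverse hΦe hn).snd.congr_of_eventuallyEq ?_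
  have hst := hΦ.contDiffAt.hasStrictFDerivAt' hΦe hn
  filter_upwards [hst.eventually_right_inverse,
    (continuousAt_fst (p := Φ (t, y))).eventually hbij] with q hq hqb
  obtain ⟨h1, h2⟩ := Prod.ext_iff.1 hq
  refine hqb.1 ?_
  rw [rayPos_rayFoot hqb, ← h2]
  simp only [Φ] at h1 ⊢
  rw [← h1]
  rfl

/-- The action carried along rays has gradient the ray momentum and solves the eikonal
equation. -/
theorem hasFDerivAt_rayAction_rayFoot [FiniteDimensional ℝ E]
    (hp : ContDiff ℝ 1 p) (hS₀ : ∀ y, HasGradientAt S₀ (p y) y)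
    (hbij : ∀ᶠ τ in 𝓝 t, Bijective (rayPos p τ)) (hd : ∀ y, ‖rayDefect p t y‖ ≤ 1 / 2) (x : E) :
    HasFDerivAt (fun q : ℝ × E => rayAction S₀ p q.1 (rayFoot p q.1 q.2))
      ((-(‖rayMom p t (rayFoot p t x)‖ ^ 2 / 2 + ‖x‖ ^ 2 / 2)) • ContinuousLinearMap.fst ℝ ℝ E +
        (innerSL ℝ (rayMom p t (rayFoot p t x))).comp (ContinuousLinearMap.snd ℝ ℝ E)) (t, x) := by
  have hpd := hp.differentiable one_ne_zero
  have hfoot := ((contDiffAt_rayFoot hp one_ne_zero hbij hd x).differentiableAt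
    one_ne_zero).hasFDerivAt
  set Y' := fderiv ℝ (fun q : ℝ × E => rayFoot p q.1 q.2) (t, x)
  set y := rayFoot p t x
  have hXy : rayPos p t y = x := rayPos_rayFoot hbij.self_of_nhds x
  have hpair : HasFDerivAt (fun q : ℝ × E => (q.1, rayFoot p q.1 q.2)) _ (t, x) :=
    hasFDerivAt_fst.prodMk hfoot
  have hcomp := HasFDerivAt.comp (g := fun q : ℝ × E => rayAction S₀ p q.1 q.2) (t, x)
    (hasFDerivAt_rayAction (t := t) (hS₀ y) (hpd y)) hpair
  have hpos := HasFDerivAt.comp (g := fun q : ℝ × E => rayPos p q.1 q.2) (t, x)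
    (hasFDerivAt_rayPos (t := t) (hpd y)) hpair
  have hid : (fun q : ℝ × E => rayPos p q.1 q.2) ∘ (fun q : ℝ × E => (q.1, rayFoot p q.1 q.2))
      =ᶠ[𝓝 (t, x)] fun q => q.2 := by
    filter_upwards [(continuousAt_fst (p := (t, x))).eventually hbij] with q hq
    exact rayPos_rayFoot hq q.2
  have hder := (hpos.congr_of_eventuallyEq hid.symm).unique hasFDerivAt_snd
  refine hcomp.congr_fderiv (ContinuousLinearMap.ext fun v => ?_)
  have hv := DFunLike.congr_fun hder v
  simp only [ContinuousLinearMap.comp_apply, add_apply,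
    ContinuousLinearMap.smulRight_apply, ContinuousLinearMap.prod_apply,
    ContinuousLinearMap.coe_fst', ContinuousLinearMap.coe_snd',
    smul_apply, smul_eq_mul, innerSL_apply_apply] at hv ⊢
  rw [← eq_sub_iff_add_eq'] at hv
  rw [hv, inner_sub_right, inner_smul_right, real_inner_self_eq_norm_sq, hXy]
  ring

end Rays

section Existence

open Function Filter Topology

theorem norm_iteratedFDeriv_gradient {E : Type*} [NormedAddCommGroup E] [InnerProductSpace ℝ E]
    [CompleteSpace E] (f : E → ℝ) (i : ℕ) (x : E) :
    ‖iteratedFDeriv ℝ i (gradient f) x‖ = ‖iteratedFDeriv ℝ (i + 1) f x‖ := by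
  let e : E ≃ₗᵢ[ℝ] StrongDual ℝ E := InnerProductSpace.toDual ℝ E
  rw [← norm_iteratedFDeriv_fderiv, ← toDual_comp_gradient]
  exact (e.norm_iteratedFDeriv_comp_left (gradient f) x i).symm

theorem exists_pos_forall_abs_cos_sub_one_add_le (K : ℝ) :
    ∃ δ > 0, ∀ t : ℝ, |t| < δ → |Real.cos t - 1| + |Real.sin t| * K ≤ 1 / 2 := by
  have hc : Tendsto (fun t : ℝ => |Real.cos t - 1| + |Real.sin t| * K) (𝓝 0) (𝓝 0) := by
    have : Continuous fun t : ℝ => |Real.cos t - 1| + |Real.sin t| * K := by fun_prop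
    simpa using this.tendsto 0
  obtain ⟨δ, hδ, h⟩ := Metric.eventually_nhds_iff.1
    (hc.eventually (ge_mem_nhds (by norm_num : (0 : ℝ) < 1 / 2)))
  exact ⟨δ, hδ, fun t ht => h (by simpa using ht)⟩

variable {E : Type*} [NormedAddCommGroup E] [InnerProductSpace ℝ E] {p : E → E} {t : ℝ}

theorem norm_rayDefect_le {K : ℝ} {y : E} (hK : ‖fderiv ℝ p y‖ ≤ K) :
    ‖rayDefect p t y‖ ≤ |Real.cos t - 1| + |Real.sin t| * K := by
  refine (norm_add_le _ _).trans (add_le_add ?_ ?_)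
  · rw [norm_smul, Real.norm_eq_abs]
    exact mul_le_of_le_one_right (abs_nonneg _) ContinuousLinearMap.norm_id_le
  · rw [norm_smul, Real.norm_eq_abs]
    gcongr

theorem fderiv_rayFoot (hp : Differentiable ℝ p) (hbij : Bijective (rayPos p t))
    (hY : Differentiable ℝ (rayFoot p t)) (x : E) :
    fderiv ℝ (rayFoot p t) x = ContinuousLinearMap.id ℝ E -
      (rayDefect p t (rayFoot p t x)).comp (fderiv ℝ (rayFoot p t) x) := by
  have h := (hasFDerivAt_rayPos_sub_id (t := t) (hp (rayFoot p t x))).comp x (hY x).hasFDerivAt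
  have hfun : (fun y => rayPos p t y - y) ∘ rayFoot p t = fun x => x - rayFoot p t x :=
    funext fun x => by simp [rayPos_rayFoot hbij]
  rw [hfun] at h
  rw [h.unique ((hasFDerivAt_id x).sub (hY x).hasFDerivAt), sub_sub_cancel]

theorem hasFDerivAt_rayMom_slice {y : E} (hp : DifferentiableAt ℝ p y) :
    HasFDerivAt (rayMom p t)
      ((-Real.sin t) • ContinuousLinearMap.id ℝ E + Real.cos t • fderiv ℝ p y) y :=
  ((hasFDerivAt_id y).const_smul (-Real.sin t)).add (hp.hasFDerivAt.const_smul (Real.cos t))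

theorem exists_isEikonalSolution {N n : ℕ} {S₀ : Esp N → ℝ}
    (hS₀ : ContDiff ℝ (n + 1 + 1 : ℕ) S₀)
    (hS₀bd : ∀ j : ℕ, 2 ≤ j → j ≤ n + 1 + 1 →
      ∃ C : ℝ, ∀ x : Esp N, ‖iteratedFDeriv ℝ j S₀ x‖ ≤ C) :
    ∃ T > (0 : ℝ), ∃ S : ℝ → Esp N → ℝ, IsEikonalSolution N (n + 1) S₀ T S := by
  set p : Esp N → Esp N := gradient S₀
  have hp : ContDiff ℝ (n + 1 : ℕ) p := by
    let e : StrongDual ℝ (Esp N) ≃ₗᵢ[ℝ] Esp N := (InnerProductSpace.toDual ℝ (Esp N)).symm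
    exact e.contDiff.comp (hS₀.fderiv_right (by norm_cast))
  have hn0 : ((n + 1 : ℕ) : WithTop ℕ∞) ≠ 0 := by positivity
  have hp1 : ContDiff ℝ 1 p := hp.of_le (by norm_cast; omega)
  have hpd : Differentiable ℝ p := hp.differentiable hn0
  have hgrad : ∀ y, HasGradientAt S₀ (p y) y := fun y =>
    (hS₀.differentiable (by positivity) y).hasGradientAt
  obtain ⟨K, hK⟩ := hS₀bd 2 le_rfl (by omega)
  have hpK : ∀ y, ‖fderiv ℝ p y‖ ≤ K := fun y => by
    rw [← norm_iteratedFDeriv_one, norm_iteratedFDeriv_gradient]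
    exact hK y
  obtain ⟨δ, hδ, hδK⟩ := exists_pos_forall_abs_cos_sub_one_add_le K
  have hd : ∀ t, |t| < δ → ∀ y, ‖rayDefect p t y‖ ≤ 1 / 2 := fun t ht y =>
    (norm_rayDefect_le (hpK y)).trans (hδK t ht)
  have hbij : ∀ t, |t| < δ → Bijective (rayPos p t) := fun t ht => rayPos_bijective hpd (hd t ht)
  have hbij' : ∀ t, |t| < δ → ∀ᶠ τ in 𝓝 t, Bijective (rayPos p τ) := fun t ht =>
    (continuous_abs.continuousAt.eventually (gt_mem_nhds ht)).mono hbij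
  have hfoot : ∀ t, |t| < δ → ∀ x,
      ContDiffAt ℝ (n + 1 : ℕ) (fun q : ℝ × Esp N => rayFoot p q.1 q.2) (t, x) :=
    fun t ht x => contDiffAt_rayFoot hp hn0 (hbij' t ht) (hd t ht) x
  have hY : ∀ t, |t| < δ → ContDiff ℝ (n + 1 : ℕ) (rayFoot p t) := fun t ht =>
    contDiff_iff_contDiffAt.2 fun x => (hfoot t ht x).comp (f := fun x => (t, x)) x
      (contDiffAt_const.prodMk contDiffAt_id)
  have hlt : ∀ t ∈ Icc 0 (δ / 2), |t| < δ := fun t ht => by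
    rw [abs_of_nonneg ht.1]; linarith [ht.2]
  let V : ℝ → Esp N → ℝ := fun t x => rayAction S₀ p t (rayFoot p t x)
  have hV : ∀ t, |t| < δ → ∀ x, HasFDerivAt (fun q : ℝ × Esp N => V q.1 q.2) _ (t, x) :=
    fun t ht x => hasFDerivAt_rayAction_rayFoot hp1 hgrad (hbij' t ht) (hd t ht) x
  have hVgrad : ∀ t, |t| < δ → gradient (V t) = fun x => rayMom p t (rayFoot p t x) := by
    intro t ht
    refine gradient_eq fun x => ?_
    have h := (hV t ht x).comp (f := fun x => (t, x)) x (hasFDerivAt_prodMk_right t x)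
    refine HasFDerivAt.congr_fderiv h ?_
    ext v
    simp [InnerProductSpace.toDual_apply_apply]
  refine ⟨δ / 2, by positivity, V, ?_, fun x => ?_, fun t ht x => ?_, fun j hj2 hjs => ?_⟩
  · rintro ⟨t, x⟩ ⟨ht, -⟩
    exact ((contDiff_rayAction (hS₀.of_le (by norm_cast; omega)) hp).contDiffAt.comp
      (f := fun q : ℝ × Esp N => (q.1, rayFoot p q.1 q.2)) (t, x)
      (contDiffAt_fst.prodMk (hfoot t (hlt t ht) x))).contDiffWithinAt
  · have h0 : rayPos p 0 = id := funext fun y => by simp [rayPos]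
    have hx : rayFoot p 0 x = x := by
      simpa [h0] using rayPos_rayFoot (hbij 0 (by simpa using hδ)) x
    simp [V, hx, rayAction, rayPos, rayMom]
  · have h := (hV t (hlt t ht) x).comp_hasDerivAt t
      ((hasDerivAt_id t).prodMk (hasDerivAt_const t x))
    refine (h.congr_deriv ?_).hasDerivWithinAt
    simp [hVgrad t (hlt t ht)]
  · let ι := Icc (0 : ℝ) (δ / 2)
    have hH : UnifContDiff n fun (_ : ι) => fderiv ℝ p := by
      refine .of_bounds (fun _ => hp.fderiv_right (by norm_cast)) fun i hi => ?_
      obtain ⟨C, hC⟩ := hS₀bd (i + 2) (by omega) (by omega)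
      refine ⟨C, fun _ x => ?_⟩
      rw [norm_iteratedFDeriv_fderiv, norm_iteratedFDeriv_gradient]
      exact hC x
    have hid : UnifContDiff n fun (_ : ι) (_ : Esp N) => ContinuousLinearMap.id ℝ (Esp N) :=
      unifContDiff_const n _
    have hcos : ∀ t : ι, |Real.cos t - 1| ≤ 2 := fun t => by
      rw [abs_le]
      constructor <;> linarith [Real.neg_one_le_cos (t : ℝ), Real.cos_le_one (t : ℝ)]
    have hB : UnifContDiff n fun t : ι => rayDefect p t :=
      (hid.smul hcos).add (hH.smul fun t : ι => Real.abs_sin_le_one t)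
    have hM : UnifContDiff n fun (t : ι) y =>
        (-Real.sin t) • ContinuousLinearMap.id ℝ (Esp N) + Real.cos t • fderiv ℝ p y :=
      (hid.smul fun t : ι => (abs_neg (Real.sin t)).trans_le (Real.abs_sin_le_one t)).add
        (hH.smul fun t : ι => Real.abs_cos_le_one t)
    have hYd : ∀ t : ι, Differentiable ℝ (rayFoot p t) := fun t =>
      (hY t (hlt t t.2)).differentiable hn0
    have hDY : UnifContDiff n fun t : ι => fderiv ℝ (rayFoot p t) :=
      unifContDiff_fderiv_of_resolvent hB (fun t => hd t (hlt t t.2))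
        (fun t => hY t (hlt t t.2))
        fun t => fderiv_rayFoot hpd (hbij t (hlt t t.2)) (hYd t)
    have hMY := (hM.comp (fun t : ι => (hY t (hlt t t.2)).of_le (by norm_cast; omega)) hDY
      (Nat.le_succ n)).clm_comp hDY
    obtain ⟨C, -, hC⟩ := hMY.bound
    obtain ⟨k, rfl⟩ : ∃ k, j = k + 2 := ⟨j - 2, by omega⟩
    refine ⟨C, fun t ht x => ?_⟩
    rw [← norm_iteratedFDeriv_gradient, ← norm_iteratedFDeriv_fderiv, hVgrad t (hlt t ht)]
    have hfd : fderiv ℝ (fun x => rayMom p t (rayFoot p t x)) = fun x =>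
        ((-Real.sin t) • ContinuousLinearMap.id ℝ (Esp N) +
          Real.cos t • fderiv ℝ p (rayFoot p t x)).comp (fderiv ℝ (rayFoot p t) x) :=
      funext fun x => ((hasFDerivAt_rayMom_slice (hpd _)).comp x
        (hYd ⟨t, ht⟩ x).hasFDerivAt).fderiv
    rw [hfd]
    exact hC k (by omega) ⟨t, ht⟩ x

end Existence

/-- If `S₀ : ℝ^N → ℝ` is `C^{s+1}` with bounded derivatives of all orders
`2 ≤ j ≤ s+1` (`s ≥ 2`), then on some time interval `[0,T]`, `T > 0`, the eikonal
equation `∂_t S + |∇_x S|²/2 + |x|²/2 = 0`, `S(0,·) = S₀` admits a solution of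
class `C^s` with spatial derivatives of orders `2,…,s` bounded uniformly, and
any two such solutions on a common interval `[0,T']` coincide there. -/
theorem eikonal_existence_uniqueness (N s : ℕ) (hN : 1 ≤ N) (hs : 2 ≤ s)
    (S₀ : Esp N → ℝ) (hS₀ : ContDiff ℝ (s + 1 : ℕ) S₀)
    (hS₀bd : ∀ j : ℕ, 2 ≤ j → j ≤ s + 1 →
      ∃ C : ℝ, ∀ x : Esp N, ‖iteratedFDeriv ℝ j S₀ x‖ ≤ C) :
    (∃ T > (0 : ℝ), ∃ S : ℝ → Esp N → ℝ, IsEikonalSolution N s S₀ T S) ∧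
    ∀ T' > (0 : ℝ), ∀ S₁ S₂ : ℝ → Esp N → ℝ,
      IsEikonalSolution N s S₀ T' S₁ → IsEikonalSolution N s S₀ T' S₂ →
      ∀ t ∈ Icc (0 : ℝ) T', ∀ x : Esp N, S₁ t x = S₂ t x := by
  refine ⟨?_, fun T' hT' S₁ S₂ h₁ h₂ t ht x =>
    le_antisymm (h₁.le h₂ hs hT' ht x) (h₂.le h₁ hs hT' ht x)⟩
  obtain ⟨n, rfl⟩ : ∃ n, s = n + 1 := ⟨s - 1, by omega⟩
  exact exists_isEikonalSolution hS₀ hS₀bd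
end
end

section
/- Let N ≥ 1 be an integer, T > 0, α ∈ ℝ. Let S : [0,T] × ℝ^N → ℝ be continuous, C² in x with ∂_t S continuous, and suppose the spatial Laplacian Δ_x S is bounded on [0,T] × ℝ^N. Let a : [0,T] × ℝ^N → ℂ be smooth, and suppose there is a compact set K ⊆ ℝ^N with a(t,x) = 0 whenever x ∉ K. Let R : [0,T] × ℝ^N → ℂ be continuous and suppose that for all (t,x) ∈ [0,T] × ℝ^N: ∂_t a + ∇_x S · ∇_x a + (1/2) a Δ_x S = (iα/2) Δ_x a + R. Then for all t ∈ [0,T]: ∫_{ℝ^N} |a(t,x)|² dx = ∫_{ℝ^N} |a(0,x)|² dx + 2 ∫₀ᵗ Re( ∫_{ℝ^N} conj(a(s,x)) R(s,x) dx ) ds. In particular ‖a(t)‖²_{L²} ≤ ‖a(0)‖²_{L²} + 2 ∫₀ᵗ ‖a(s)‖_{L²} ‖R(s)‖_{L²} ds. -/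
open MeasureTheory Set
open scoped ENNReal ComplexConjugate

noncomputable section

/-- The Laplacian of `f : ℝ^N → F`: the sum of the second derivatives of `f`
along the coordinate directions. -/
def lapl {N : ℕ} {F : Type*} [NormedAddCommGroup F] [NormedSpace ℝ F]
    (f : Esp N → F) (x : Esp N) : F :=
  ∑ i : Fin N,
    fderiv ℝ (fun y => fderiv ℝ f y (EuclideanSpace.single i 1)) x
      (EuclideanSpace.single i 1)

/-- The integral of a directional derivative of a compactly supported `C¹` function vanishes. -/
theorem integral_fderiv_apply_eq_zero {E : Type*} [NormedAddCommGroup E] [NormedSpace ℝ E]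
    [FiniteDimensional ℝ E] [MeasurableSpace E] [BorelSpace E] {μ : Measure E}
    [μ.IsAddHaarMeasure] {f : E → ℝ} (hf : ContDiff ℝ 1 f) (hc : HasCompactSupport f) (v : E) :
    ∫ x, fderiv ℝ f x v ∂μ = 0 := by
  have hint : Integrable (fun x => fderiv ℝ f x v) μ :=
    ((hf.continuous_fderiv one_ne_zero).clm_apply continuous_const).integrable_of_hasCompactSupport
      (hc.fderiv_apply (𝕜 := ℝ) v)
  have key := integral_mul_fderiv_eq_neg_fderiv_mul_of_integrable (μ := μ) (𝕜 := ℝ)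
    (f := fun _ : E => (1 : ℝ)) (g := f) (v := v) (by simp) (by simpa using hint)
    (by simpa using hf.continuous.integrable_of_hasCompactSupport hc)
    (fun x _ => differentiableAt_const _) (fun x _ => hf.differentiable one_ne_zero x)
  simpa using key

/-- The `i`-th partial derivative on `ℝ^N`. -/
def partialDeriv {N : ℕ} {F : Type*} [NormedAddCommGroup F] [NormedSpace ℝ F]
    (i : Fin N) (f : Esp N → F) (x : Esp N) : F :=
  fderiv ℝ f x (EuclideanSpace.single i 1)

theorem lapl_eq_sum_partialDeriv {N : ℕ} {F : Type*} [NormedAddCommGroup F] [NormedSpace ℝ F]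
    (f : Esp N → F) (x : Esp N) :
    lapl f x = ∑ i, partialDeriv i (partialDeriv i f) x := rfl

theorem ContDiff.partialDeriv {N : ℕ} {F : Type*} [NormedAddCommGroup F] [NormedSpace ℝ F]
    {f : Esp N → F} (hf : ContDiff ℝ 2 f) (i : Fin N) : ContDiff ℝ 1 (partialDeriv i f) :=
  (hf.fderiv_right (m := 1) (by norm_num)).clm_apply contDiff_const

theorem fderiv_apply_gradient {N : ℕ} {F : Type*} [NormedAddCommGroup F] [NormedSpace ℝ F]
    (u : Esp N → F) (φ : Esp N → ℝ) (x : Esp N) :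
    fderiv ℝ u x (gradient φ x) = ∑ i, partialDeriv i φ x • partialDeriv i u x := by
  have hg : gradient φ x =
      ∑ i, partialDeriv i φ x • (EuclideanSpace.single i (1 : ℝ) : Esp N) := by
    conv_lhs => rw [← (EuclideanSpace.basisFun (Fin N) ℝ).sum_repr' (gradient φ x)]
    simp [inner_gradient_right, partialDeriv]
  rw [hg]
  simp [partialDeriv]

/-- The `i`-th component of the energy flux of `u`: its divergence collects the contributions of
the transport and Schrödinger terms to the time derivative of `|u|²`. -/
def energyFlux {N : ℕ} (α : ℝ) (φ : Esp N → ℝ) (u : Esp N → ℂ) (i : Fin N) (x : Esp N) : ℝ :=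
  (conj (u x) * u x).re * partialDeriv i φ x + α * (conj (u x) * partialDeriv i u x).im

theorem contDiff_energyFlux {N : ℕ} (α : ℝ) {φ : Esp N → ℝ} {u : Esp N → ℂ}
    (hφ : ContDiff ℝ 2 φ) (hu : ContDiff ℝ 2 u) (i : Fin N) :
    ContDiff ℝ 1 (energyFlux α φ u i) := by
  have h1 : ContDiff ℝ 1 u := hu.of_le (by norm_num)
  have hc : ContDiff ℝ 1 (fun x => conj (u x)) := Complex.conjCLE.contDiff.comp h1
  exact ((Complex.reCLM.contDiff.comp (hc.mul h1)).mul (hφ.partialDeriv i)).add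
    (contDiff_const.mul (Complex.imCLM.contDiff.comp (hc.mul (hu.partialDeriv i))))

theorem hasCompactSupport_energyFlux {N : ℕ} (α : ℝ) (φ : Esp N → ℝ) {u : Esp N → ℂ}
    (hc : HasCompactSupport u) (i : Fin N) : HasCompactSupport (energyFlux α φ u i) :=
  hc.mono fun x hx hux => hx (by simp [energyFlux, hux])

theorem partialDeriv_energyFlux {N : ℕ} (α : ℝ) {φ : Esp N → ℝ} {u : Esp N → ℂ}
    (hφ : ContDiff ℝ 2 φ) (hu : ContDiff ℝ 2 u) (i : Fin N) (x : Esp N) :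
    partialDeriv i (energyFlux α φ u i) x =
      2 * (conj (u x) * (partialDeriv i φ x • partialDeriv i u x)).re
        + (conj (u x) * u x).re * partialDeriv i (partialDeriv i φ) x
        + α * (conj (u x) * partialDeriv i (partialDeriv i u) x).im := by
  have line {F : Type} [NormedAddCommGroup F] [NormedSpace ℝ F] {f : Esp N → F}
      (hf : ContDiff ℝ 1 f) : HasDerivAt
        (fun t : ℝ => f (x + t • EuclideanSpace.single i 1)) (partialDeriv i f x) 0 :=
    (hf.differentiable one_ne_zero x).hasFDerivAt.hasLineDerivAt _
  have h1 := line (hu.of_le (by norm_num))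
  have h2 := line (hu.partialDeriv i)
  have h3 := line (hφ.partialDeriv i)
  have hc := Complex.conjCLE.toContinuousLinearMap.hasFDerivAt.comp_hasDerivAt 0 h1
  have hre := Complex.reCLM.hasFDerivAt.comp_hasDerivAt 0 (hc.mul h1)
  have him := Complex.imCLM.hasFDerivAt.comp_hasDerivAt 0 (hc.mul h2)
  have hF := (hre.mul h3).add (him.const_mul α)
  rw [(line (contDiff_energyFlux α hφ hu i)).unique hF]
  simp
  ring

/-- For a solution at a frozen time, only the source contributes to the variation of the energy. -/
theorem integral_two_mul_re_conj_mul_eq {N : ℕ} {α : ℝ} {φ : Esp N → ℝ} {u r ut : Esp N → ℂ}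
    (hφ : ContDiff ℝ 2 φ) (hu : ContDiff ℝ 2 u) (hc : HasCompactSupport u) (hr : Continuous r)
    (hpde : ∀ x, ut x + fderiv ℝ u x (gradient φ x) + (1 / 2 : ℂ) * u x * ((lapl φ x : ℝ) : ℂ) =
      Complex.I * (α : ℂ) / 2 * lapl u x + r x) :
    ∫ x, 2 * (conj (u x) * ut x).re = 2 * (∫ x, conj (u x) * r x).re := by
  have hpt (x : Esp N) : 2 * (conj (u x) * ut x).re =
      2 * (conj (u x) * r x).re - ∑ i, partialDeriv i (energyFlux α φ u i) x := by
    have hut : ut x = Complex.I * (α : ℂ) / 2 * lapl u x + r x - fderiv ℝ u x (gradient φ x)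
        - (1 / 2 : ℂ) * u x * ((lapl φ x : ℝ) : ℂ) := by linear_combination hpde x
    have hsum : ∑ i, partialDeriv i (energyFlux α φ u i) x =
        2 * (conj (u x) * fderiv ℝ u x (gradient φ x)).re + (conj (u x) * u x).re * lapl φ x
          + α * (conj (u x) * lapl u x).im := by
      simp_rw [partialDeriv_energyFlux α hφ hu, Finset.sum_add_distrib, ← Finset.mul_sum,
        ← Complex.re_sum, ← Complex.im_sum, ← Finset.mul_sum, fderiv_apply_gradient,
        lapl_eq_sum_partialDeriv]
    rw [hsum, hut]
    simp
    ring
  have hur : Integrable (fun x => conj (u x) * r x) :=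
    ((Complex.continuous_conj.comp hu.continuous).mul hr).integrable_of_hasCompactSupport
      (hc.mono fun x hx hux => hx (by simp [hux]))
  have hflux (i : Fin N) : Integrable (fun x => partialDeriv i (energyFlux α φ u i) x) :=
    (((contDiff_energyFlux α hφ hu i).continuous_fderiv one_ne_zero).clm_apply
      continuous_const).integrable_of_hasCompactSupport
      ((hasCompactSupport_energyFlux α φ hc i).fderiv_apply (𝕜 := ℝ) _)
  have hre : ∫ x, (conj (u x) * r x).re = (∫ x, conj (u x) * r x).re := integral_re hur
  simp_rw [hpt]
  have hre2 : Integrable (fun x => 2 * (conj (u x) * r x).re) := hur.re.const_mul 2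
  rw [integral_sub hre2 (integrable_finsetSum _ fun i _ => hflux i),
    integral_const_mul, integral_finsetSum _ fun i _ => hflux i, hre, sub_eq_self]
  exact Finset.sum_eq_zero fun i _ => integral_fderiv_apply_eq_zero
    (contDiff_energyFlux α hφ hu i) (hasCompactSupport_energyFlux α φ hc i) _

theorem eLpNorm_two_sq_eq_ofReal {X F : Type*} [MeasurableSpace X] {μ : Measure X}
    [NormedAddCommGroup F] {f : X → F} (hf : MemLp f 2 μ) :
    eLpNorm f 2 μ ^ 2 = ENNReal.ofReal (∫ x, ‖f x‖ ^ 2 ∂μ) := by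
  rw [hf.eLpNorm_eq_integral_rpow_norm two_ne_zero ENNReal.ofNat_ne_top,
    ← ENNReal.ofReal_pow (by positivity)]
  congr 1
  simp only [ENNReal.toReal_ofNat, Real.rpow_two]
  rw [← Real.rpow_natCast, ← Real.rpow_mul (integral_nonneg fun x => by positivity)]
  norm_num

theorem enorm_re_integral_conj_mul_le {X : Type*} [MeasurableSpace X] {μ : Measure X}
    {f g : X → ℂ} (hf : AEStronglyMeasurable f μ) (hg : AEStronglyMeasurable g μ) :
    ‖(∫ x, conj (f x) * g x ∂μ).re‖ₑ ≤ eLpNorm f 2 μ * eLpNorm g 2 μ := by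
  calc ‖(∫ x, conj (f x) * g x ∂μ).re‖ₑ ≤ ‖∫ x, conj (f x) * g x ∂μ‖ₑ := by
        rw [enorm_le_iff_norm_le]
        exact Complex.abs_re_le_norm _
    _ ≤ eLpNorm (fun x => conj (f x) * g x) 1 μ := by
        rw [eLpNorm_one_eq_lintegral_enorm]
        exact enorm_integral_le_lintegral_enorm _
    _ ≤ eLpNorm f 2 μ * eLpNorm g 2 μ := by
        simpa using eLpNorm_le_eLpNorm_mul_eLpNorm_of_nnnorm (p := 2) (q := 2) (r := 1) hf hg
          (fun z w => conj z * w) 1 (.of_forall fun x => by simp)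

/-- A time-integrated form of `d/dt ∫ |a|² = ∫ 2 Re (conj a ∂ₜa)` for a function which is `C¹` on
`[0,T] × ℝ^N` and supported in `[0,T] × K`. -/
theorem integral_norm_sq_sub_integral_norm_sq {E : Type*} [NormedAddCommGroup E]
    [NormedSpace ℝ E] [FiniteDimensional ℝ E] [MeasurableSpace E] [BorelSpace E] {μ : Measure E}
    [IsFiniteMeasureOnCompacts μ] [SFinite μ] {T : ℝ} (hT : 0 < T) {a : ℝ → E → ℂ}
    (ha : ContDiffOn ℝ 1 (fun p : ℝ × E => a p.1 p.2) (Icc 0 T ×ˢ univ))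
    {K : Set E} (hKc : IsCompact K) (hK : ∀ t ∈ Icc (0 : ℝ) T, ∀ x ∉ K, a t x = 0)
    {t : ℝ} (ht : t ∈ Icc (0 : ℝ) T) :
    (∫ x, ‖a t x‖ ^ 2 ∂μ) - ∫ x, ‖a 0 x‖ ^ 2 ∂μ =
      ∫ s in (0 : ℝ)..t,
        ∫ x, 2 * (conj (a s x) * derivWithin (fun τ => a τ x) (Icc 0 T) s).re ∂μ := by
  set q : ℝ → E → ℝ := fun s x =>
    2 * (conj (a s x) * derivWithin (fun τ => a τ x) (Icc 0 T) s).re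
  have h0 : (0 : ℝ) ∈ Icc 0 T := ⟨le_rfl, hT.le⟩
  have hderiv (s) (hs : s ∈ Icc 0 T) (x : E) : HasDerivWithinAt (fun τ => a τ x)
      (fderivWithin ℝ (fun p : ℝ × E => a p.1 p.2) (Icc 0 T ×ˢ univ) (s, x) (1, 0))
      (Icc 0 T) s :=
    HasFDerivWithinAt.comp_hasDerivWithinAt (f := fun τ => (τ, x)) s
      (ha.differentiableOn one_ne_zero (s, x) ⟨hs, mem_univ _⟩).hasFDerivWithinAt
      ((hasDerivAt_id s).prodMk (hasDerivAt_const s x)).hasDerivWithinAt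
      fun τ hτ => ⟨hτ, mem_univ _⟩
  have huniq : UniqueDiffOn ℝ (Icc 0 T ×ˢ univ : Set (ℝ × E)) :=
    (uniqueDiffOn_Icc hT).prod uniqueDiffOn_univ
  have hat : ContinuousOn
      (fun p : ℝ × E => derivWithin (fun τ => a τ p.2) (Icc 0 T) p.1) (Icc 0 T ×ˢ univ) :=
    ((ha.continuousOn_fderivWithin huniq le_rfl).clm_apply
      (continuousOn_const (c := ((1, 0) : ℝ × E)))).congr fun p hp =>
        (hderiv p.1 hp.1 p.2).derivWithin (uniqueDiffOn_Icc hT p.1 hp.1)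
  have hq : ContinuousOn (Function.uncurry q) (Icc 0 T ×ˢ univ) :=
    continuousOn_const.mul (Complex.continuous_re.comp_continuousOn
      ((Complex.continuous_conj.comp_continuousOn ha.continuousOn).mul hat))
  have hq0 (s) (hs : s ∈ Icc 0 T) (x) (hx : x ∉ K) : q s x = 0 := by simp [q, hK s hs x hx]
  have hftc (x : E) : ∫ s in (0 : ℝ)..t, q s x = ‖a t x‖ ^ 2 - ‖a 0 x‖ ^ 2 := by
    have hcont : ContinuousOn (fun s => q s x) (Icc 0 t) :=
      hq.comp (f := fun s => (s, x)) (by fun_prop)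
        fun s hs => ⟨⟨hs.1, hs.2.trans ht.2⟩, mem_univ _⟩
    have hac : ContinuousOn (fun s => a s x) (Icc 0 t) :=
      ha.continuousOn.comp (f := fun s => (s, x)) (by fun_prop)
        fun s hs => ⟨⟨hs.1, hs.2.trans ht.2⟩, mem_univ _⟩
    refine intervalIntegral.integral_eq_sub_of_hasDerivAt_of_le ht.1 (hac.norm.pow 2)
      (fun s hs => ?_) (hcont.intervalIntegrable_of_Icc ht.1)
    have hs' : s ∈ Ioo 0 T := ⟨hs.1, hs.2.trans_le ht.2⟩
    have hd := (hderiv s (Ioo_subset_Icc_self hs') x).differentiableWithinAt.hasDerivWithinAt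
    have hqs : q s x = 2 * inner ℝ (a s x) (derivWithin (fun τ => a τ x) (Icc 0 T) s) := by
      simp [q, Complex.inner, mul_comm]
    rw [hqs]
    exact (hd.hasDerivAt (Icc_mem_nhds hs'.1 hs'.2)).norm_sq
  have hint (s) (hs : s ∈ Icc 0 T) : Integrable (fun x => ‖a s x‖ ^ 2) μ := by
    have hc : Continuous (a s) := continuousOn_univ.1
      (ha.continuousOn.comp (f := fun x => (s, x)) (by fun_prop) fun x _ => ⟨hs, mem_univ _⟩)
    exact (hc.norm.pow 2).integrable_of_hasCompactSupport
      (HasCompactSupport.intro hKc fun x hx => by simp [hK s hs x hx])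
  have hprod : Integrable (Function.uncurry fun x s => q s x)
      ((μ.restrict K).prod (volume.restrict (Ioc 0 t))) := by
    rw [Measure.prod_restrict]
    refine IntegrableOn.mono_set (t := K ×ˢ Icc 0 t) ?_ (prod_mono_right Ioc_subset_Icc_self)
    exact (hq.comp (f := Prod.swap) (by fun_prop)
      fun p hp => ⟨⟨hp.2.1, hp.2.2.trans ht.2⟩, mem_univ _⟩).integrableOn_compact
      (hKc.prod isCompact_Icc)
  rw [← integral_sub (hint t ht) (hint 0 h0)]
  calc ∫ x, ‖a t x‖ ^ 2 - ‖a 0 x‖ ^ 2 ∂μ = ∫ x in K, ‖a t x‖ ^ 2 - ‖a 0 x‖ ^ 2 ∂μ :=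
        (setIntegral_eq_integral_of_forall_compl_eq_zero fun x hx => by
          simp [hK t ht x hx, hK 0 h0 x hx]).symm
    _ = ∫ x in K, (∫ s in Ioc 0 t, q s x) ∂μ := by
        simp_rw [← hftc, intervalIntegral.integral_of_le ht.1]
    _ = ∫ s in Ioc 0 t, ∫ x in K, q s x ∂μ := integral_integral_swap hprod
    _ = ∫ s in Ioc 0 t, ∫ x, q s x ∂μ :=
        setIntegral_congr_fun measurableSet_Ioc fun s hs =>
          setIntegral_eq_integral_of_forall_compl_eq_zero (hq0 s ⟨hs.1.le, hs.2.trans ht.2⟩)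
    _ = ∫ s in (0 : ℝ)..t, ∫ x, q s x ∂μ := (intervalIntegral.integral_of_le ht.1).symm

/-- The `L²` energy estimate for the transport equation
`∂_t a + ∇_x S·∇_x a + (1/2) a Δ_x S = (iα/2) Δ_x a + R` on `[0,T] × ℝ^N`:
the exact energy identity
`∫|a(t)|² = ∫|a(0)|² + 2∫₀ᵗ Re(∫ conj(a) R) ds`, and the resulting bound
`‖a(t)‖²_{L²} ≤ ‖a(0)‖²_{L²} + 2∫₀ᵗ ‖a(s)‖_{L²}‖R(s)‖_{L²} ds`. -/
theorem transport_energy_estimate (N : ℕ) (hN : 1 ≤ N) (T : ℝ) (hT : 0 < T)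
    (α : ℝ) (S : ℝ → Esp N → ℝ) (a : ℝ → Esp N → ℂ) (R : ℝ → Esp N → ℂ)
    (hScont : ContinuousOn (fun p : ℝ × Esp N => S p.1 p.2) (Icc 0 T ×ˢ univ))
    (hSx : ∀ t ∈ Icc (0 : ℝ) T, ContDiff ℝ 2 (S t))
    (hSt : ContinuousOn
      (fun p : ℝ × Esp N => derivWithin (fun τ : ℝ => S τ p.2) (Icc 0 T) p.1)
      (Icc 0 T ×ˢ univ))
    (hΔS : ∃ C : ℝ, ∀ t ∈ Icc (0 : ℝ) T, ∀ x : Esp N, |lapl (S t) x| ≤ C)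
    (ha : ContDiffOn ℝ (⊤ : ℕ∞) (fun p : ℝ × Esp N => a p.1 p.2) (Icc 0 T ×ˢ univ))
    (hK : ∃ K : Set (Esp N), IsCompact K ∧
      ∀ t ∈ Icc (0 : ℝ) T, ∀ x : Esp N, x ∉ K → a t x = 0)
    (hR : ContinuousOn (fun p : ℝ × Esp N => R p.1 p.2) (Icc 0 T ×ˢ univ))
    (hPDE : ∀ t ∈ Icc (0 : ℝ) T, ∀ x : Esp N,
      derivWithin (fun τ : ℝ => a τ x) (Icc 0 T) t +
          fderiv ℝ (a t) x (gradient (S t) x) +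
          (1 / 2 : ℂ) * a t x * ((lapl (S t) x : ℝ) : ℂ) =
        Complex.I * (α : ℂ) / 2 * lapl (a t) x + R t x) :
    ∀ t ∈ Icc (0 : ℝ) T,
      (∫ x : Esp N, ‖a t x‖ ^ 2) =
          (∫ x : Esp N, ‖a 0 x‖ ^ 2) +
            2 * ∫ s in (0 : ℝ)..t, (∫ x : Esp N, conj (a s x) * R s x).re ∧
        eLpNorm (a t) 2 volume ^ 2 ≤
          eLpNorm (a 0) 2 volume ^ 2 +
            2 * ∫⁻ s in Ioc (0 : ℝ) t,
              eLpNorm (a s) 2 volume * eLpNorm (R s) 2 volume := by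
  intro t ht
  obtain ⟨K, hKc, hK⟩ := hK
  have h0 : (0 : ℝ) ∈ Icc 0 T := ⟨le_rfl, hT.le⟩
  have hax (s) (hs : s ∈ Icc 0 T) : ContDiff ℝ 2 (a s) := contDiffOn_univ.1
    ((ha.of_le (by norm_cast)).comp (f := fun x => (s, x))
      (contDiff_const.prodMk contDiff_id).contDiffOn fun x _ => ⟨hs, mem_univ _⟩)
  have hRx (s) (hs : s ∈ Icc 0 T) : Continuous (R s) := continuousOn_univ.1
    (hR.comp (f := fun x => (s, x)) (by fun_prop) fun x _ => ⟨hs, mem_univ _⟩)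
  have hsupp (s) (hs : s ∈ Icc 0 T) : HasCompactSupport (a s) :=
    HasCompactSupport.intro hKc (hK s hs)
  have henergy : (∫ x, ‖a t x‖ ^ 2) - ∫ x, ‖a 0 x‖ ^ 2 =
      2 * ∫ s in (0 : ℝ)..t, (∫ x, conj (a s x) * R s x).re := by
    rw [integral_norm_sq_sub_integral_norm_sq hT (ha.of_le (by norm_cast)) hKc hK ht,
      ← intervalIntegral.integral_const_mul]
    refine intervalIntegral.integral_congr fun s hs => ?_
    rw [uIcc_of_le ht.1] at hs
    have hs' : s ∈ Icc 0 T := ⟨hs.1, hs.2.trans ht.2⟩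
    exact integral_two_mul_re_conj_mul_eq (hSx s hs') (hax s hs') (hsupp s hs') (hRx s hs')
      (hPDE s hs')
  have hid := sub_eq_iff_eq_add'.1 henergy
  refine ⟨hid, ?_⟩
  have hmem (s) (hs : s ∈ Icc 0 T) : MemLp (a s) 2 volume :=
    (hax s hs).continuous.memLp_of_hasCompactSupport (hsupp s hs)
  rw [eLpNorm_two_sq_eq_ofReal (hmem t ht), eLpNorm_two_sq_eq_ofReal (hmem 0 h0), hid]
  refine ENNReal.ofReal_add_le.trans (add_le_add le_rfl ?_)
  rw [ENNReal.ofReal_mul zero_le_two, ENNReal.ofReal_ofNat]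
  gcongr
  rw [intervalIntegral.integral_of_le ht.1]
  refine (Real.ofReal_le_enorm _).trans ((enorm_integral_le_lintegral_enorm _).trans ?_)
  refine setLIntegral_mono' measurableSet_Ioc fun s hs => ?_
  have hs' : s ∈ Icc 0 T := ⟨hs.1.le, hs.2.trans ht.2⟩
  exact enorm_re_integral_conj_mul_le (hax s hs').continuous.aestronglyMeasurable
    (hRx s hs').aestronglyMeasurable
end
end
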